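/- Let (G_k) be a sequence of finite simple graphs such that: (i) for every r ∈ ℕ, the proportion of (3,r)-tree-like vertices of G_k tends to 1 as k → ∞; and (ii) the average degree 2·|E(G_k)|/|V(G_k)| tends to 3 as k → ∞. Then limsup_{k→∞} ( min{ size(S)/|V(G_k)| : S a bisection of G_k } ) < (3/(2π))·arccos(2√2/3). -/

import Mathlib

open Filter Real

/-- `x` is a `(d,r)`-tree-like vertex of `H`: the subgraph induced on the ball of radius
`r` about `x` is acyclic, and every vertex at distance at most `r-1` from `x` has degree
exactly `d` in `H`. -/
def TreeLikeVtx {W : Type*} (H : SimpleGraph W) (d r : ℕ) (x : W) : Prop :=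
  (H.induce {y : W | H.Reachable x y ∧ H.dist x y ≤ r}).IsAcyclic ∧
    ∀ y : W, H.Reachable x y → H.dist x y + 1 ≤ r → (H.neighborSet y).ncard = d

/-- `S` is a bisection: its size and the size of its complement differ by at most 1. -/
def IsBisection {W : Type*} (S : Set W) : Prop :=
  S.ncard ≤ Sᶜ.ncard + 1 ∧ Sᶜ.ncard ≤ S.ncard + 1

/-- The size of the bisection `S`: the number of edges with exactly one endpoint in `S`. -/
noncomputable def bisectionSize {W : Type*} (H : SimpleGraph W) (S : Set W) : ℕ :=
  {e ∈ H.edgeSet | ∃ u v : W, e = s(u, v) ∧ u ∈ S ∧ v ∉ S}.ncard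

section Deterministic

variable {W : Type*} [DecidableEq W]

/-- Changing the sign of `s` at `v`. -/
def flipAt (s : W → ℝ) (v : W) : W → ℝ := Function.update s v (-s v)

lemma flipAt_of_ne {s : W → ℝ} {v x : W} (h : x ≠ v) : flipAt s v x = s x :=
  Function.update_of_ne h _ _

lemma flipAt_self {s : W → ℝ} {v : W} : flipAt s v v = -s v :=
  Function.update_self _ _ _

lemma flipAt_sign {s : W → ℝ} (hs : ∀ x, s x = 1 ∨ s x = -1) (v : W) (x : W) :
    flipAt s v x = 1 ∨ flipAt s v x = -1 := by
  by_cases h : x = v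
  · subst h
    rw [flipAt_self]
    rcases hs x with h | h <;> simp [h]
  · rw [flipAt_of_ne h]
    exact hs x

lemma flipAt_eq_add (s : W → ℝ) (v x : W) :
    flipAt s v x = s x + if x = v then -2 * s v else 0 := by
  by_cases h : x = v
  · subst h
    rw [flipAt_self, if_pos rfl]
    ring
  · rw [flipAt_of_ne h, if_neg h, add_zero]

variable [Fintype W] (G : SimpleGraph W) [DecidableRel G.Adj]

/-- The number of edges on which the `±1`-labelling `s` is not constant. -/
noncomputable def cutValue (s : W → ℝ) : ℝ :=
  (∑ x, ∑ y, if G.Adj x y then 1 - s x * s y else 0) / 4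

variable {G}

lemma sum_flipAt (s : W → ℝ) (v : W) : ∑ x, flipAt s v x = ∑ x, s x - 2 * s v := by
  simp only [flipAt_eq_add, Finset.sum_add_distrib, Finset.sum_ite_eq', Finset.mem_univ, if_true]
  ring

lemma cutValue_flipAt (s : W → ℝ) (v : W) :
    cutValue G (flipAt s v) = cutValue G s + ∑ w ∈ G.neighborFinset v, s v * s w := by
  have key : ∀ x y, (if G.Adj x y then 1 - flipAt s v x * flipAt s v y else 0) =
      (if G.Adj x y then 1 - s x * s y else 0)
      + (if y = v then (if G.Adj x v then 2 * (s v * s x) else 0) else 0)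
      + (if x = v then (if G.Adj v y then 2 * (s v * s y) else 0) else 0) := by
    intro x y
    rw [flipAt_eq_add, flipAt_eq_add]
    by_cases hx : x = v
    · by_cases hy : y = v
      · subst hx; subst hy
        simp
      · subst hx
        by_cases h : G.Adj x y <;> simp [h, hy] <;> ring
    · by_cases hy : y = v
      · subst hy
        by_cases h : G.Adj x y <;> simp [h, hx] <;> ring
      · simp [hx, hy]
  have h1 : ∑ w ∈ G.neighborFinset v, s v * s w = ∑ w, if G.Adj v w then s v * s w else 0 := by
    rw [← Finset.sum_filter]
    congr 1
    ext; simp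
  unfold cutValue
  simp only [key, Finset.sum_add_distrib, Finset.sum_ite_eq', Finset.mem_univ, if_true]
  rw [Finset.sum_comm (f := fun x y => if x = v then _ else _)]
  simp only [Finset.sum_ite_eq', Finset.mem_univ, if_true]
  have h2 : ∑ x, (if G.Adj x v then 2 * (s v * s x) else 0) =
      2 * ∑ w ∈ G.neighborFinset v, s v * s w := by
    rw [h1, Finset.mul_sum]
    refine Finset.sum_congr rfl fun x _ => ?_
    simp [G.adj_comm x v]
  have h3 : ∑ x, (if G.Adj v x then 2 * (s v * s x) else 0) =
      2 * ∑ w ∈ G.neighborFinset v, s v * s w := by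
    rw [h1, Finset.mul_sum]
    refine Finset.sum_congr rfl fun x _ => ?_
    simp
  rw [h2, h3]
  ring

lemma mul_le_one_of_sign {a b : ℝ} (ha : a = 1 ∨ a = -1) (hb : b = 1 ∨ b = -1) : a * b ≤ 1 := by
  rcases ha with rfl | rfl <;> rcases hb with rfl | rfl <;> norm_num

lemma cutValue_flipAt_le {s : W → ℝ} (hs : ∀ x, s x = 1 ∨ s x = -1) {v : W}
    (hv : G.degree v = 3) : cutValue G (flipAt s v) ≤ cutValue G s + 3 := by
  rw [cutValue_flipAt]
  have : ∑ w ∈ G.neighborFinset v, s v * s w ≤ ∑ w ∈ G.neighborFinset v, (1 : ℝ) :=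
    Finset.sum_le_sum fun w _ => mul_le_one_of_sign (hs v) (hs w)
  rw [Finset.sum_const, SimpleGraph.card_neighborFinset_eq_degree, hv] at this
  norm_num at this
  linarith

/-- At `v` the labelling `s` disagrees with at least two neighbours. -/
def Frustrated (G : SimpleGraph W) (s : W → ℝ) (v : W) : Prop :=
  ∃ a b, a ≠ b ∧ G.Adj v a ∧ G.Adj v b ∧ s a = -s v ∧ s b = -s v

lemma cutValue_flipAt_le_of_frustrated {s : W → ℝ} (hs : ∀ x, s x = 1 ∨ s x = -1) {v : W}
    (hv : G.degree v = 3) (hf : Frustrated G s v) :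
    cutValue G (flipAt s v) ≤ cutValue G s - 1 := by
  obtain ⟨a, b, hab, ha, hb, hsa, hsb⟩ := hf
  rw [cutValue_flipAt]
  have hsub : ({a, b} : Finset W) ⊆ G.neighborFinset v := by
    intro x hx
    simp only [Finset.mem_insert, Finset.mem_singleton] at hx
    rcases hx with rfl | rfl <;> simpa
  have hvv : s v * s v = 1 := by rcases hs v with h | h <;> rw [h] <;> norm_num
  rw [← Finset.sum_sdiff hsub, Finset.sum_pair hab, hsa, hsb]
  have h1 : ∑ w ∈ G.neighborFinset v \ {a, b}, s v * s w ≤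
      ∑ w ∈ G.neighborFinset v \ {a, b}, (1 : ℝ) :=
    Finset.sum_le_sum fun w _ => mul_le_one_of_sign (hs v) (hs w)
  rw [Finset.sum_const, Finset.card_sdiff_of_subset hsub,
    SimpleGraph.card_neighborFinset_eq_degree, hv, Finset.card_pair hab] at h1
  norm_num at h1
  linarith

lemma Frustrated.flipAt {s : W → ℝ} {v x : W} (hx : Frustrated G s x) (hne : x ≠ v)
    (hadj : ¬ G.Adj v x) : Frustrated G (flipAt s v) x := by
  obtain ⟨a, b, hab, ha, hb, hsa, hsb⟩ := hx
  refine ⟨a, b, hab, ha, hb, ?_, ?_⟩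
  · rw [flipAt_of_ne hne, flipAt_of_ne, hsa]
    rintro rfl; exact hadj ha.symm
  · rw [flipAt_of_ne hne, flipAt_of_ne, hsb]
    rintro rfl; exact hadj hb.symm

/-- Swapping well separated frustrated vertices of opposite signs improves the cut without
changing the balance. -/
lemma exists_frustrated_swaps (q : ℕ) : ∀ (s : W → ℝ), (∀ x, s x = 1 ∨ s x = -1) → ∀ A B : Finset W,
    (∀ v ∈ A, G.degree v = 3 ∧ Frustrated G s v ∧ s v = 1) →
    (∀ v ∈ B, G.degree v = 3 ∧ Frustrated G s v ∧ s v = -1) →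
    8 * q ≤ A.card → 8 * q ≤ B.card →
    ∃ s' : W → ℝ, (∀ x, s' x = 1 ∨ s' x = -1) ∧ ∑ x, s' x = ∑ x, s x ∧
      cutValue G s' ≤ cutValue G s - 2 * q := by
  induction q with
  | zero => exact fun s hs A B _ _ _ _ => ⟨s, hs, rfl, by simp⟩
  | succ q ih =>
    intro s hs A B hA hB hAc hBc
    have hN : ∀ v, G.degree v = 3 → (insert v (G.neighborFinset v)).card ≤ 4 := by
      intro v hv
      refine (Finset.card_insert_le _ _).trans ?_
      rw [SimpleGraph.card_neighborFinset_eq_degree, hv]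
    obtain ⟨a, haA⟩ : A.Nonempty := Finset.card_pos.mp (by omega)
    obtain ⟨had, haf, has⟩ := hA a haA
    obtain ⟨b, hb⟩ : (B \ insert a (G.neighborFinset a)).Nonempty := by
      apply Finset.card_pos.mp
      have := Finset.le_card_sdiff (insert a (G.neighborFinset a)) B
      have := hN a had
      omega
    simp only [Finset.mem_sdiff, Finset.mem_insert, SimpleGraph.mem_neighborFinset, not_or] at hb
    obtain ⟨hbB, hba, hnab⟩ := hb
    obtain ⟨hbd, hbf, hbs⟩ := hB b hbB
    have hbf' := hbf.flipAt hba hnab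
    have h1 := cutValue_flipAt_le_of_frustrated hs had haf
    have h2 := cutValue_flipAt_le_of_frustrated (flipAt_sign hs a) hbd hbf'
    set U := insert a (G.neighborFinset a) ∪ insert b (G.neighborFinset b) with hU
    have hUc : U.card ≤ 8 := (Finset.card_union_le _ _).trans (by
      have := hN a had; have := hN b hbd; omega)
    have hkeep : ∀ x, x ∉ U → Frustrated G s x →
        Frustrated G (flipAt (flipAt s a) b) x ∧ flipAt (flipAt s a) b x = s x := by
      intro x hx hf
      simp only [hU, Finset.mem_union, Finset.mem_insert, SimpleGraph.mem_neighborFinset,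
        not_or] at hx
      obtain ⟨⟨hx1, hx2⟩, hx3, hx4⟩ := hx
      exact ⟨(hf.flipAt hx1 hx2).flipAt hx3 hx4, by rw [flipAt_of_ne hx3, flipAt_of_ne hx1]⟩
    obtain ⟨s', hs', hsum, hcut⟩ := ih (flipAt (flipAt s a) b)
      (flipAt_sign (flipAt_sign hs a) b) (A \ U) (B \ U)
      (fun v hv => by
        rw [Finset.mem_sdiff] at hv
        obtain ⟨h1, h2, h3⟩ := hA v hv.1
        obtain ⟨h4, h5⟩ := hkeep v hv.2 h2
        exact ⟨h1, h4, h5.trans h3⟩)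
      (fun v hv => by
        rw [Finset.mem_sdiff] at hv
        obtain ⟨h1, h2, h3⟩ := hB v hv.1
        obtain ⟨h4, h5⟩ := hkeep v hv.2 h2
        exact ⟨h1, h4, h5.trans h3⟩)
      (by have := Finset.le_card_sdiff U A; omega)
      (by have := Finset.le_card_sdiff U B; omega)
    refine ⟨s', hs', ?_, ?_⟩
    · rw [hsum, sum_flipAt, sum_flipAt, flipAt_of_ne hba, has, hbs]
      ring
    · push_cast
      linarith

lemma exists_mem_of_sum_large {s : W → ℝ} (hs : ∀ x, s x = 1 ∨ s x = -1) {T : Finset W}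
    (hT : 2 * Tᶜ.card ≤ Fintype.card W) {ε : ℝ} (hε : ε = 1 ∨ ε = -1)
    (h : 0 < ε * ∑ x, s x) : ∃ v ∈ T, s v = ε := by
  by_contra! hcon
  have h1 : ∀ x, ε * s x ≤ 2 * (if x ∈ Tᶜ then 1 else 0) - 1 := by
    intro x
    by_cases hx : x ∈ T
    · have := hcon x hx
      rcases hs x with h | h <;> rcases hε with h' | h' <;> simp_all
    · have := mul_le_one_of_sign hε (hs x)
      simp only [Finset.mem_compl, hx, not_false_eq_true, if_true]
      linarith
  have h2 : ε * ∑ x, s x ≤ 2 * (Tᶜ.card : ℝ) - Fintype.card W := by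
    rw [Finset.mul_sum]
    refine (Finset.sum_le_sum fun x _ => h1 x).trans ?_
    rw [Finset.sum_sub_distrib, ← Finset.mul_sum, Finset.sum_ite_mem, Finset.univ_inter]
    simp
  have : (2 * Tᶜ.card : ℝ) ≤ Fintype.card W := by exact_mod_cast hT
  linarith

/-- Any labelling can be balanced at bounded cost per unit of imbalance. -/
lemma exists_balanced {T : Finset W} (hT : 2 * Tᶜ.card ≤ Fintype.card W)
    (hdeg : ∀ v ∈ T, G.degree v = 3) (m : ℕ) : ∀ s : W → ℝ, (∀ x, s x = 1 ∨ s x = -1) →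
    |∑ x, s x| ≤ m → ∃ s' : W → ℝ, (∀ x, s' x = 1 ∨ s' x = -1) ∧ |∑ x, s' x| ≤ 1 ∧
      cutValue G s' ≤ cutValue G s + 3 / 2 * |∑ x, s x| := by
  induction m using Nat.strong_induction_on with
  | _ m ih =>
    intro s hs hm
    by_cases h1 : |∑ x, s x| ≤ 1
    · exact ⟨s, hs, h1, by have := abs_nonneg (∑ x, s x); linarith⟩
    push Not at h1
    obtain ⟨z, hz⟩ : ∃ z : ℤ, ∑ x, s x = z := by
      refine ⟨∑ x, if s x = 1 then 1 else -1, ?_⟩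
      push_cast
      refine Finset.sum_congr rfl fun x _ => ?_
      rcases hs x with h | h <;> rw [h] <;> norm_num
    have hz2 : 2 ≤ |z| := by
      rw [hz] at h1
      have : (1 : ℤ) < |z| := by exact_mod_cast h1
      omega
    have hz2' : (2 : ℝ) ≤ |∑ x, s x| := by rw [hz]; exact_mod_cast hz2
    obtain ⟨ε, hε, hεs⟩ : ∃ ε : ℝ, (ε = 1 ∨ ε = -1) ∧ ε * ∑ x, s x = |∑ x, s x| := by
      rcases abs_cases (∑ x, s x) with h | h
      · exact ⟨1, Or.inl rfl, by rw [h.1, one_mul]⟩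
      · exact ⟨-1, Or.inr rfl, by rw [h.1]; ring⟩
    obtain ⟨v, hvT, hv⟩ := exists_mem_of_sum_large hs hT hε (by linarith)
    have hεε : ε * ε = 1 := by rcases hε with rfl | rfl <;> norm_num
    have hnew : |∑ x, flipAt s v x| = |∑ x, s x| - 2 := by
      rw [sum_flipAt, hv]
      have : ∑ x, s x = ε * |∑ x, s x| := by rw [← hεs, ← mul_assoc, hεε, one_mul]
      rw [show ∑ x, s x - 2 * ε = ε * (|∑ x, s x| - 2) by linear_combination this, abs_mul,
        abs_of_nonneg (by linarith : 0 ≤ |∑ x, s x| - 2)]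
      rcases hε with rfl | rfl <;> simp
    have hm2 : 2 ≤ m := by exact_mod_cast hz2'.trans hm
    obtain ⟨s', hs', hb, hc⟩ := ih (m - 2) (by omega) (flipAt s v) (flipAt_sign hs v) (by
      rw [hnew]; push_cast [hm2]; linarith)
    refine ⟨s', hs', hb, hc.trans ?_⟩
    have := cutValue_flipAt_le hs (hdeg v hvT)
    rw [hnew]
    linarith

lemma isBisection_of_balanced {s : W → ℝ} (hs : ∀ x, s x = 1 ∨ s x = -1)
    (h : |∑ x, s x| ≤ 1) : IsBisection {x | s x = 1} := by
  have h1 : ({x | s x = 1} : Set W).ncard = (Finset.univ.filter fun x => s x = 1).card := by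
    rw [← Set.ncard_coe_finset]; congr 1; ext; simp
  have h2 : ({x | s x = 1}ᶜ : Set W).ncard = (Finset.univ.filter fun x => ¬ s x = 1).card := by
    rw [← Set.ncard_coe_finset]; congr 1; ext; simp
  have h3 : ∑ x, s x = ((Finset.univ.filter fun x => s x = 1).card : ℝ)
      - (Finset.univ.filter fun x => ¬ s x = 1).card := by
    rw [← Finset.sum_filter_add_sum_filter_not Finset.univ (fun x => s x = 1)]
    rw [Finset.sum_congr rfl (g := fun _ => (1 : ℝ)) (by simp),
      Finset.sum_congr (s₁ := Finset.univ.filter fun x => ¬ s x = 1) rfl (g := fun _ => (-1 : ℝ))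
        (fun x hx => (hs x).resolve_left (by simpa using hx))]
    simp [sub_eq_add_neg]
  rw [h3, abs_le] at h
  unfold IsBisection
  rw [h1, h2]
  constructor
  · have := h.2
    rw [sub_le_iff_le_add, add_comm] at this
    exact_mod_cast this
  · have := h.1
    rw [neg_le_sub_iff_le_add] at this
    exact_mod_cast this

lemma bisectionSize_le_cutValue {s : W → ℝ} (hs : ∀ x, s x = 1 ∨ s x = -1) :
    (bisectionSize G {x | s x = 1} : ℝ) ≤ cutValue G s := by
  set P := (Finset.univ : Finset (W × W)).filter
    fun p => G.Adj p.1 p.2 ∧ s p.1 = 1 ∧ ¬ s p.2 = 1 with hP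
  have h1 : bisectionSize G {x | s x = 1} ≤ P.card := by
    unfold bisectionSize
    refine le_trans ?_ (Finset.card_image_le (f := fun p : W × W => s(p.1, p.2)))
    rw [← Set.ncard_coe_finset]
    refine Set.ncard_le_ncard ?_ (Finset.finite_toSet _)
    rintro e ⟨he, u, v, rfl, hu, hv⟩
    simp only [Finset.coe_image, Set.mem_image, Finset.mem_coe]
    exact ⟨(u, v), by simpa [hP] using ⟨he, hu, hv⟩, rfl⟩
  have h2 : (P.card : ℝ) = ∑ x, ∑ y, if G.Adj x y ∧ s x = 1 ∧ ¬ s y = 1 then 1 else 0 := by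
    rw [← Fintype.sum_prod_type' (f := fun x y => if G.Adj x y ∧ s x = 1 ∧ ¬ s y = 1
      then (1 : ℝ) else 0), hP, Finset.sum_boole]
  have h3 : (P.card : ℝ) = ∑ x, ∑ y, if G.Adj x y ∧ s y = 1 ∧ ¬ s x = 1 then 1 else 0 := by
    rw [h2, Finset.sum_comm]
    simp only [G.adj_comm]
  have h4 : cutValue G s = ((P.card : ℝ) + P.card) / 2 := by
    nth_rewrite 1 [h2]
    rw [h3]
    unfold cutValue
    simp only [← Finset.sum_add_distrib, Finset.sum_div]
    refine Finset.sum_congr rfl fun x _ => Finset.sum_congr rfl fun y _ => ?_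
    by_cases h : G.Adj x y
    · rcases hs x with hx | hx <;> rcases hs y with hy | hy <;> simp [h, hx, hy] <;> norm_num
    · simp [h]
  rw [h4]
  have : (bisectionSize G {x | s x = 1} : ℝ) ≤ P.card := by exact_mod_cast h1
  linarith

/-- The bisection obtained from a labelling by swapping frustrated vertices and balancing. -/
lemma exists_bisection_le {T : Finset W} (hT : 2 * Tᶜ.card ≤ Fintype.card W)
    (hdeg : ∀ v ∈ T, G.degree v = 3) {s : W → ℝ} (hs : ∀ x, s x = 1 ∨ s x = -1)
    {c : W → ℝ} (hc : ∀ v ∈ T, c v = 0 ∨ c v = 1 ∧ Frustrated G s v) :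
    ∃ S : Set W, IsBisection S ∧ (bisectionSize G S : ℝ) ≤ cutValue G s
      + 3 / 2 * (|∑ v ∈ T, s v| + Tᶜ.card) + 2
      - (∑ v ∈ T, c v - |∑ v ∈ T, s v * c v|) / 8 := by
  set A := T.filter fun v => c v = 1 ∧ s v = 1 with hA
  set B := T.filter fun v => c v = 1 ∧ s v = -1 with hB
  have hsplit : ∀ v ∈ T, c v = (if c v = 1 ∧ s v = 1 then 1 else 0) +
      (if c v = 1 ∧ s v = -1 then 1 else 0) ∧ s v * c v = (if c v = 1 ∧ s v = 1 then 1 else 0) -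
      (if c v = 1 ∧ s v = -1 then 1 else 0) := by
    intro v hv
    rcases hc v hv with h | ⟨h, -⟩ <;> rcases hs v with h' | h' <;> rw [h, h'] <;> norm_num
  have h1 : ∑ v ∈ T, c v = (A.card : ℝ) + B.card := by
    rw [Finset.sum_congr rfl fun v hv => (hsplit v hv).1, Finset.sum_add_distrib,
      Finset.sum_boole, Finset.sum_boole]
  have h2 : ∑ v ∈ T, s v * c v = (A.card : ℝ) - B.card := by
    rw [Finset.sum_congr rfl fun v hv => (hsplit v hv).2, Finset.sum_sub_distrib,
      Finset.sum_boole, Finset.sum_boole]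
  obtain ⟨q, hqA, hqB, hq⟩ : ∃ q : ℕ, 8 * q ≤ A.card ∧ 8 * q ≤ B.card ∧
      (min A.card B.card : ℝ) ≤ 8 * q + 8 := by
    refine ⟨min A.card B.card / 8, by omega, by omega, ?_⟩
    have : min A.card B.card ≤ 8 * (min A.card B.card / 8) + 8 := by omega
    exact_mod_cast this
  have hfr : ∀ v ∈ T, c v = 1 → Frustrated G s v := fun v hv h =>
    (hc v hv).elim (fun h0 => by rw [h] at h0; norm_num at h0) And.right
  obtain ⟨s₁, hs₁, hsum₁, hcut₁⟩ := exists_frustrated_swaps q s hs A B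
    (fun v hv => by
      obtain ⟨h, h', h''⟩ := Finset.mem_filter.mp hv
      exact ⟨hdeg v h, hfr v h h', h''⟩)
    (fun v hv => by
      obtain ⟨h, h', h''⟩ := Finset.mem_filter.mp hv
      exact ⟨hdeg v h, hfr v h h', h''⟩) hqA hqB
  obtain ⟨m, hm⟩ := exists_nat_ge |∑ x, s₁ x|
  obtain ⟨s₂, hs₂, hsum₂, hcut₂⟩ := exists_balanced hT hdeg m s₁ hs₁ hm
  refine ⟨_, isBisection_of_balanced hs₂ hsum₂, (bisectionSize_le_cutValue hs₂).trans ?_⟩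
  have h3 : |∑ x, s x| ≤ |∑ v ∈ T, s v| + Tᶜ.card := by
    rw [← Finset.sum_add_sum_compl T]
    refine (abs_add_le _ _).trans (add_le_add_right ?_ _)
    refine (Finset.abs_sum_le_sum_abs _ _).trans ?_
    refine (Finset.sum_le_sum (g := fun _ => (1 : ℝ)) fun x _ => ?_).trans (by simp)
    rcases hs x with h | h <;> simp [h]
  rw [hsum₁] at hcut₂
  have h4 : ((A.card : ℝ) + B.card) - |(A.card : ℝ) - B.card| = 2 * min (A.card : ℝ) B.card := by
    rcases le_total (A.card : ℝ) B.card with h | h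
    · rw [min_eq_left h, abs_of_nonpos (by linarith)]; ring
    · rw [min_eq_right h, abs_of_nonneg (by linarith)]; ring
  rw [h1, h2, h4]
  linarith

end Deterministic

section LocalTree

variable {W : Type*} {G : SimpleGraph W}

/-- The graph looks like the 3-regular tree around `v`, expressed through distances to `v`. -/
structure IsLocalTree (G : SimpleGraph W) (R : ℕ) (v : W) : Prop where
  ncard_neighborSet : ∀ u, G.Reachable v u → G.dist v u < R → (G.neighborSet u).ncard = 3
  dist_ne : ∀ u y, G.Reachable v u → G.dist v u < R → G.Adj u y → G.dist v y ≠ G.dist v u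
  eq_of_dist_lt : ∀ u y y', G.Reachable v u → G.dist v u < R → G.Adj u y → G.Adj u y' →
    G.dist v y < G.dist v u → G.dist v y' < G.dist v u → y = y'

lemma SimpleGraph.IsAcyclic.eq_of_isPath_of_support_subset {B : Set W}
    (hB : (G.induce B).IsAcyclic) {v u : W} {p q : G.Walk v u} (hp : p.IsPath) (hq : q.IsPath)
    (hpB : ∀ x ∈ p.support, x ∈ B) (hqB : ∀ x ∈ q.support, x ∈ B) : p = q := by
  have h1 := p.map_induce hpB
  have h2 := q.map_induce hqB
  have hp' : (p.induce B hpB).IsPath := by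
    apply SimpleGraph.Walk.IsPath.of_map (f := (SimpleGraph.Embedding.induce B).toHom)
    rw [h1]; exact hp
  have hq' : (q.induce B hqB).IsPath := by
    apply SimpleGraph.Walk.IsPath.of_map (f := (SimpleGraph.Embedding.induce B).toHom)
    rw [h2]; exact hq
  have := (hB.subsingleton_path _ _).elim ⟨_, hp'⟩ ⟨_, hq'⟩
  exact h1.symm.trans ((congrArg _ (Subtype.ext_iff.mp this)).trans h2)

lemma dist_adj_bounds {v u y : W} (hr : G.Reachable v u) (h : G.Adj u y) :
    G.Reachable v y ∧ G.dist v y ≤ G.dist v u + 1 ∧ G.dist v u ≤ G.dist v y + 1 := by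
  have hy := hr.trans h.reachable
  have h1 := hr.dist_triangle_left y
  have h2 := hy.dist_triangle_left u
  rw [SimpleGraph.dist_eq_one_iff_adj.mpr h] at h1
  rw [SimpleGraph.dist_eq_one_iff_adj.mpr h.symm] at h2
  exact ⟨hy, h1, h2⟩

/-- The distances from two adjacent vertices differ by at most one. -/
lemma adj_dist_bounds {v w u : W} (hvw : G.Adj v w) (hr : G.Reachable v u) :
    G.Reachable w u ∧ G.dist w u ≤ G.dist v u + 1 ∧ G.dist v u ≤ G.dist w u + 1 := by
  obtain ⟨h1, h2, h3⟩ := dist_adj_bounds hr.symm hvw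
  rw [G.dist_comm (u := u), G.dist_comm (u := u)] at h2 h3
  exact ⟨h1.symm, h2, h3⟩

lemma exists_adj_dist_add_one {v u : W} (hr : G.Reachable v u) (hne : v ≠ u) :
    ∃ y, G.Adj u y ∧ G.Reachable v y ∧ G.dist v y + 1 = G.dist v u := by
  obtain ⟨p, hp⟩ := hr.symm.exists_walk_length_eq_dist
  cases p with
  | nil => exact absurd rfl hne
  | @cons _ y _ h q =>
    obtain ⟨hy, h1, h2⟩ := dist_adj_bounds hr h
    refine ⟨y, h, hy, ?_⟩
    have := SimpleGraph.dist_le q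
    rw [SimpleGraph.Walk.length_cons, G.dist_comm] at hp
    rw [G.dist_comm] at this
    omega

lemma support_subset_ball {v u : W} (p : G.Walk v u) {R : ℕ} (hp : p.length ≤ R) :
    ∀ x ∈ p.support, x ∈ {y : W | G.Reachable v y ∧ G.dist v y ≤ R} := by
  classical
  intro x hx
  refine ⟨(p.takeUntil x hx).reachable, (SimpleGraph.dist_le (p.takeUntil x hx)).trans ?_⟩
  exact (p.length_takeUntil_le_length hx).trans hp

lemma TreeLikeVtx.isLocalTree {R : ℕ} {v : W} (h : TreeLikeVtx G 3 R v) : IsLocalTree G R v := by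
  classical
  obtain ⟨hac, hdeg⟩ := h
  refine ⟨fun u hu hR => hdeg u hu hR, ?_, ?_⟩
  · intro u y hu hR hadj heq
    obtain ⟨hy, -, -⟩ := dist_adj_bounds hu hadj
    obtain ⟨p, hpp, hpl⟩ := hu.exists_path_of_dist
    obtain ⟨q, hqp, hql⟩ := hy.exists_path_of_dist
    have hyp : y ∉ p.support := by
      intro hmem
      have h1 := SimpleGraph.dist_le (p.takeUntil y hmem)
      have h2 := SimpleGraph.Walk.length_takeUntil_lt_length hmem hadj.ne'
      omega
    have := hac.eq_of_isPath_of_support_subset (hpp.concat hyp hadj) hqp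
      (support_subset_ball _ (by rw [SimpleGraph.Walk.length_concat]; omega))
      (support_subset_ball _ (by omega))
    have := congrArg SimpleGraph.Walk.length this
    rw [SimpleGraph.Walk.length_concat] at this
    omega
  · intro u y y' hu hR hadj hadj' hlt hlt'
    obtain ⟨hy, -, h1⟩ := dist_adj_bounds hu hadj
    obtain ⟨hy', -, h1'⟩ := dist_adj_bounds hu hadj'
    obtain ⟨p, hp⟩ := hy.exists_walk_length_eq_dist
    obtain ⟨q, hq⟩ := hy'.exists_walk_length_eq_dist
    have hpl : (p.concat hadj.symm).length = G.dist v u := by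
      rw [SimpleGraph.Walk.length_concat]; omega
    have hql : (q.concat hadj'.symm).length = G.dist v u := by
      rw [SimpleGraph.Walk.length_concat]; omega
    have := hac.eq_of_isPath_of_support_subset
      ((p.concat hadj.symm).isPath_of_length_eq_dist hpl)
      ((q.concat hadj'.symm).isPath_of_length_eq_dist hql)
      (support_subset_ball _ (by omega)) (support_subset_ball _ (by omega))
    have := congrArg SimpleGraph.Walk.penultimate this
    simpa using this

lemma TreeLikeVtx.of_adj {R : ℕ} {v w : W} (h : TreeLikeVtx G 3 (R + 1) v) (hvw : G.Adj v w) :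
    TreeLikeVtx G 3 R w := by
  have key : ∀ y, G.Reachable w y → G.Reachable v y ∧ G.dist v y ≤ G.dist w y + 1 := by
    intro y hy
    obtain ⟨h1, h2, -⟩ := adj_dist_bounds hvw.symm hy
    exact ⟨h1, h2⟩
  refine ⟨?_, fun y hy hR => ?_⟩
  · have hsub : {y : W | G.Reachable w y ∧ G.dist w y ≤ R} ⊆
        {y : W | G.Reachable v y ∧ G.dist v y ≤ R + 1} := fun y hy =>
      ⟨(key y hy.1).1, (key y hy.1).2.trans (by have := hy.2; omega)⟩
    exact h.1.comap (G.induceHomOfLE hsub).toHom (G.induceHomOfLE hsub).injective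
  · obtain ⟨h1, h2⟩ := key y hy
    exact h.2 y h1 (by omega)

/-- Adjacent vertices are at different distances from every vertex of the tree-like ball. -/
lemma IsLocalTree.dist_ne_of_adj {R : ℕ} {v w : W} (hv : IsLocalTree G R v) (hvw : G.Adj v w) :
    ∀ (j : ℕ) (u : W), G.Reachable w u → G.dist w u = j → j < R → G.dist v u ≠ j := by
  intro j
  induction j with
  | zero =>
    intro u hu h0 _ hv0
    have h1 := hu.dist_eq_zero_iff.mp h0
    subst h1
    rw [SimpleGraph.dist_eq_one_iff_adj.mpr hvw] at hv0
    omega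
  | succ j ih =>
    intro u hu hj hR hvj
    obtain ⟨y, hy, hwy, hyj⟩ := exists_adj_dist_add_one hu (by rintro rfl; simp at hj)
    have h1 := ih y hwy (by omega) (by omega)
    have hvu : G.Reachable v u := hvw.reachable.trans hu
    obtain ⟨hvy, h2, h3⟩ := dist_adj_bounds hvu hy
    have h4 := hv.dist_ne u y hvu (by omega) hy
    obtain ⟨-, h5, h6⟩ := adj_dist_bounds hvw.symm hwy
    omega

/-- Each vertex of the tree-like ball lies behind only one neighbour of the root. -/
lemma IsLocalTree.eq_of_dist_add_one {R : ℕ} {v : W} (hv : IsLocalTree G R v) {y y' : W}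
    (hy : G.Adj v y) (hy' : G.Adj v y') : ∀ (j : ℕ) (u : W), G.Reachable v u →
    G.dist v u = j + 1 → j + 1 < R → G.dist y u = j → G.dist y' u = j → y = y' := by
  intro j
  induction j with
  | zero =>
    intro u hu _ _ h h'
    rw [(hy.symm.reachable.trans hu).dist_eq_zero_iff] at h
    rw [(hy'.symm.reachable.trans hu).dist_eq_zero_iff] at h'
    rw [h, h']
  | succ j ih =>
    intro u hu hd hR h h'
    obtain ⟨p, hp, hvp, hpd⟩ := exists_adj_dist_add_one hu (by rintro rfl; simp at hd)
    have key : ∀ x, G.Adj v x → G.dist x u = j + 1 → G.dist x p = j := by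
      intro x hx hxu
      have hxr := hx.symm.reachable.trans hu
      obtain ⟨q, hq, hxq, hqd⟩ := exists_adj_dist_add_one hxr (by rintro rfl; simp at hxu)
      obtain ⟨-, h1, h2⟩ := dist_adj_bounds hxq.symm hx.symm
      rw [G.dist_comm, G.dist_comm (v := x)] at h1
      have := hv.eq_of_dist_lt u p q hu (by omega) hp hq (by omega) (by omega)
      rw [this]; omega
    exact ih p hvp (by omega) (by omega) (key y hy h) (key y' hy' h')

open scoped Classical in
/-- The function `u ↦ F (dist v u)`, extended by zero outside the component of `v`. -/
noncomputable def radial (G : SimpleGraph W) (F : ℕ → ℝ) (v u : W) : ℝ :=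
  if G.Reachable v u then F (G.dist v u) else 0

variable [Fintype W]

open scoped Classical in
/-- For adjacent `v` and `w`: the vertices at distance `j` from `v` on the side away from `w`. -/
noncomputable def branch (G : SimpleGraph W) (v w : W) (j : ℕ) : Finset W :=
  Finset.univ.filter fun u => G.Reachable v u ∧ G.dist v u = j ∧ G.dist w u = j + 1

lemma mem_branch {v w u : W} {j : ℕ} :
    u ∈ branch G v w j ↔ G.Reachable v u ∧ G.dist v u = j ∧ G.dist w u = j + 1 := by
  simp [branch]

open scoped Classical in
/-- The ball of radius `m` about `v`. -/
noncomputable def distBall (G : SimpleGraph W) (v : W) (m : ℕ) : Finset W :=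
  Finset.univ.filter fun u => G.Reachable v u ∧ G.dist v u ≤ m

lemma mem_distBall {v u : W} {m : ℕ} :
    u ∈ distBall G v m ↔ G.Reachable v u ∧ G.dist v u ≤ m := by
  simp [distBall]

variable [DecidableRel G.Adj]

lemma IsLocalTree.degree_eq {R : ℕ} {v : W} (hv : IsLocalTree G R v) {u : W}
    (hu : G.Reachable v u) (h : G.dist v u < R) : G.degree u = 3 := by
  rw [← hv.ncard_neighborSet u hu h, ← SimpleGraph.card_neighborFinset_eq_degree,
    ← Set.ncard_coe_finset, SimpleGraph.coe_neighborFinset]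

variable [DecidableEq W]

lemma card_branch {R : ℕ} {v w : W} (hv : IsLocalTree G R v) (hw : IsLocalTree G R w)
    (hvw : G.Adj v w) (j : ℕ) (hj : j < R) : (branch G v w j).card = 2 ^ j := by
  induction j with
  | zero =>
    have : branch G v w 0 = {v} := by
      ext u
      rw [mem_branch, Finset.mem_singleton]
      constructor
      · rintro ⟨h1, h2, -⟩
        exact (h1.dist_eq_zero_iff.mp h2).symm
      · rintro rfl
        exact ⟨SimpleGraph.Reachable.refl _, by simp,
          SimpleGraph.dist_eq_one_iff_adj.mpr hvw.symm⟩
    rw [this]; simp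
  | succ j ih =>
    have key := Finset.card_mul_eq_card_mul (s := branch G v w j) (t := branch G v w (j + 1))
      (m := 2) (n := 1) G.Adj ?_ ?_
    · rw [ih (by omega), mul_one] at key
      rw [← key, pow_succ]
    · intro u hu
      obtain ⟨hu, hvu, hwu⟩ := mem_branch.mp hu
      have hwr : G.Reachable w u := hvw.symm.reachable.trans hu
      obtain ⟨z, hz, hwz, hzd⟩ := exists_adj_dist_add_one hwr (by rintro rfl; simp at hwu)
      have : (branch G v w (j + 1)).bipartiteAbove G.Adj u = (G.neighborFinset u).erase z := by
        ext y
        simp only [Finset.mem_bipartiteAbove, mem_branch, Finset.mem_erase,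
          SimpleGraph.mem_neighborFinset]
        constructor
        · rintro ⟨⟨-, -, h3⟩, h4⟩
          exact ⟨by rintro rfl; omega, h4⟩
        · rintro ⟨hyz, hy⟩
          obtain ⟨hvy, h1, h2⟩ := dist_adj_bounds hu hy
          obtain ⟨hwy, h3, h4⟩ := dist_adj_bounds hwr hy
          have h5 := hw.dist_ne u y hwr (by omega) hy
          have h6 : ¬ G.dist w y < G.dist w u := fun h =>
            hyz (hw.eq_of_dist_lt u y z hwr (by omega) hy hz h (by omega))
          obtain ⟨-, h7, h8⟩ := adj_dist_bounds hvw hvy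
          exact ⟨⟨hvy, by omega, by omega⟩, hy⟩
      rw [this, Finset.card_erase_of_mem (by simpa using hz),
        SimpleGraph.card_neighborFinset_eq_degree, hv.degree_eq hu (by omega)]
    · intro y hy
      obtain ⟨hy, hvy, hwy⟩ := mem_branch.mp hy
      obtain ⟨u, hu, hvu, hud⟩ := exists_adj_dist_add_one hy (by rintro rfl; simp at hvy)
      have hwr : G.Reachable w y := hvw.symm.reachable.trans hy
      rw [Finset.card_eq_one]
      refine ⟨u, ?_⟩
      ext x
      simp only [Finset.mem_bipartiteBelow, mem_branch, Finset.mem_singleton]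
      constructor
      · rintro ⟨⟨-, h2, -⟩, h4⟩
        exact hv.eq_of_dist_lt y x u hy (by omega) h4.symm hu (by omega) (by omega)
      · rintro rfl
        obtain ⟨-, h3, h4⟩ := dist_adj_bounds hwr hu
        obtain ⟨-, h7, h8⟩ := adj_dist_bounds hvw hvu
        exact ⟨⟨hvu, by omega, by omega⟩, hu.symm⟩

lemma sum_radial_mul_radial {R r : ℕ} {v w : W} (hv : IsLocalTree G R v) (hw : IsLocalTree G R w)
    (hvw : G.Adj v w) (hr : r < R) {F : ℕ → ℝ} (hF : ∀ j, r < j → F j = 0) (H : ℕ → ℝ) :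
    ∑ u, radial G F v u * radial G H w u =
      ∑ j ∈ Finset.range (r + 1), 2 ^ j * (F j * H (j + 1) + F (j + 1) * H j) := by
  have key : ∀ u, radial G F v u * radial G H w u = ∑ j ∈ Finset.range (r + 1),
      ((if u ∈ branch G v w j then F j * H (j + 1) else 0)
        + (if u ∈ branch G w v j then F (j + 1) * H j else 0)) := by
    intro u
    by_cases hu : G.Reachable v u
    · have hwu : G.Reachable w u := hvw.symm.reachable.trans hu
      obtain ⟨-, h1, h2⟩ := adj_dist_bounds hvw hu
      simp only [radial, hu, hwu, if_true, mem_branch, true_and]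
      rcases (by omega : G.dist w u = G.dist v u + 1 ∨ G.dist v u = G.dist w u + 1 ∨
        G.dist v u = G.dist w u) with h | h | h
      · rw [Finset.sum_eq_single (G.dist v u)]
        · rw [if_pos ⟨rfl, h⟩, if_neg (by omega), h, add_zero]
        · intro j _ hj
          rw [if_neg (by omega), if_neg (by omega), add_zero]
        · intro hj
          rw [Finset.mem_range] at hj
          rw [hF (G.dist v u) (by omega), zero_mul, ite_self, if_neg (by omega), add_zero]
      · rw [Finset.sum_eq_single (G.dist w u)]
        · rw [if_neg (by omega), if_pos ⟨rfl, h⟩, h, zero_add]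
        · intro j _ hj
          rw [if_neg (by omega), if_neg (by omega), add_zero]
        · intro hj
          rw [Finset.mem_range] at hj
          rw [hF (G.dist w u + 1) (by omega), if_neg (by omega)]
          simp
      · have hlt : r < G.dist v u := by
          by_contra hle
          exact hv.dist_ne_of_adj hvw (G.dist v u) u hwu h.symm (by omega) rfl
        rw [hF _ hlt, zero_mul]
        symm
        refine Finset.sum_eq_zero fun j _ => ?_
        rw [if_neg (by omega), if_neg (by omega), add_zero]
    · have hwu : ¬ G.Reachable w u := fun h => hu (hvw.reachable.trans h)
      simp [radial, mem_branch, hu, hwu]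
  rw [Finset.sum_congr rfl fun u _ => key u, Finset.sum_comm]
  refine Finset.sum_congr rfl fun j hj => ?_
  rw [Finset.mem_range] at hj
  rw [Finset.sum_add_distrib, Finset.sum_ite_mem, Finset.sum_ite_mem, Finset.univ_inter,
    Finset.univ_inter, Finset.sum_const, Finset.sum_const, card_branch hv hw hvw j (by omega),
    card_branch hw hv hvw.symm j (by omega)]
  simp only [nsmul_eq_mul]
  push_cast
  ring

/-- The radial profile of the sum of `radial G F` over the neighbours of a vertex. -/
def neighborProfile (F : ℕ → ℝ) : ℕ → ℝ
  | 0 => 3 * F 1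
  | j + 1 => F j + 2 * F (j + 2)

lemma sum_neighbor_radial {R r : ℕ} {v : W} (hv : IsLocalTree G R v) (hr : r + 2 ≤ R)
    {F : ℕ → ℝ} (hF : ∀ j, r < j → F j = 0) (u : W) :
    ∑ y ∈ G.neighborFinset v, radial G F y u = radial G (neighborProfile F) v u := by
  have hd : G.degree v = 3 := hv.degree_eq (SimpleGraph.Reachable.refl _) (by simp; omega)
  by_cases hu : G.Reachable v u
  swap
  · rw [radial, if_neg hu]
    refine Finset.sum_eq_zero fun y hy => if_neg fun h => hu ?_
    exact ((G.mem_neighborFinset v y).mp hy).reachable.trans h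
  have hb : ∀ y ∈ G.neighborFinset v, G.Adj v y ∧ G.Reachable y u ∧
      G.dist y u ≤ G.dist v u + 1 ∧ G.dist v u ≤ G.dist y u + 1 := by
    intro y hy
    have hvy := (G.mem_neighborFinset v y).mp hy
    exact ⟨hvy, adj_dist_bounds hvy hu⟩
  have hval : radial G (neighborProfile F) v u = neighborProfile F (G.dist v u) := if_pos hu
  have hval' : ∀ y ∈ G.neighborFinset v, radial G F y u = F (G.dist y u) :=
    fun y hy => if_pos (hb y hy).2.1
  rw [hval, Finset.sum_congr rfl hval']
  by_cases hlt : G.dist v u < R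
  swap
  · rw [Finset.sum_eq_zero fun y hy => hF _ (by have := hb y hy; omega)]
    obtain ⟨k, hk⟩ : ∃ k, G.dist v u = k + 1 := ⟨G.dist v u - 1, by omega⟩
    rw [hk, neighborProfile, hF k (by omega), hF (k + 2) (by omega)]
    simp
  rcases Nat.eq_zero_or_pos (G.dist v u) with h0 | hpos
  · have := hu.dist_eq_zero_iff.mp h0
    subst this
    have h1 : ∀ y ∈ G.neighborFinset v, F (G.dist y v) = F 1 := fun y hy => by
      rw [SimpleGraph.dist_eq_one_iff_adj.mpr (hb y hy).1.symm]
    rw [Finset.sum_congr rfl h1, Finset.sum_const, SimpleGraph.card_neighborFinset_eq_degree, hd,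
      h0, neighborProfile]
    simp
  · obtain ⟨k, hk⟩ : ∃ k, G.dist v u = k + 1 := ⟨G.dist v u - 1, by omega⟩
    obtain ⟨z, hz, hzu, hzd⟩ := exists_adj_dist_add_one hu.symm (by rintro rfl; simp at hk)
    rw [G.dist_comm, G.dist_comm (v := v)] at hzd
    have h1 : ∀ y ∈ (G.neighborFinset v).erase z, F (G.dist y u) = F (k + 2) := by
      intro y hy
      rw [Finset.mem_erase] at hy
      obtain ⟨h1, h2, h3, h4⟩ := hb y hy.2
      have h5 : G.dist y u ≠ k := fun h =>
        hy.1 (hv.eq_of_dist_add_one h1 hz k u hu hk (by omega) h (by omega))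
      have h6 : G.dist y u ≠ k + 1 := fun h =>
        hv.dist_ne_of_adj h1 (k + 1) u h2 h (by omega) hk
      rw [show G.dist y u = k + 2 by omega]
    have hzm : z ∈ G.neighborFinset v := (G.mem_neighborFinset v z).mpr hz
    rw [← Finset.add_sum_erase _ _ hzm, Finset.sum_congr rfl h1, Finset.sum_const,
      Finset.card_erase_of_mem hzm, SimpleGraph.card_neighborFinset_eq_degree, hd, hk,
      neighborProfile, show G.dist z u = k by omega]
    simp

lemma card_distBall_le {R : ℕ} {v : W} (hv : IsLocalTree G R v) (m : ℕ) (hm : m ≤ R) :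
    (distBall G v m).card ≤ 4 ^ m := by
  induction m with
  | zero =>
    have : distBall G v 0 = {v} := by
      ext u
      rw [mem_distBall, Finset.mem_singleton, Nat.le_zero]
      exact ⟨fun ⟨h1, h2⟩ => (h1.dist_eq_zero_iff.mp h2).symm, by rintro rfl; simp⟩
    rw [this]; simp
  | succ m ih =>
    have hsub : distBall G v (m + 1) ⊆
        (distBall G v m).biUnion fun u => insert u (G.neighborFinset u) := by
      intro u hu
      obtain ⟨h1, h2⟩ := mem_distBall.mp hu
      rw [Finset.mem_biUnion]
      by_cases hvu : v = u
      · exact ⟨u, mem_distBall.mpr ⟨h1, by subst hvu; simp⟩, Finset.mem_insert_self _ _⟩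
      · obtain ⟨y, hy, hvy, hyd⟩ := exists_adj_dist_add_one h1 hvu
        exact ⟨y, mem_distBall.mpr ⟨hvy, by omega⟩, Finset.mem_insert_of_mem (by simpa using hy.symm)⟩
    refine (Finset.card_le_card hsub).trans ?_
    refine (Finset.card_biUnion_le_card_mul _ _ 4 fun u hu => ?_).trans ?_
    · obtain ⟨h1, h2⟩ := mem_distBall.mp hu
      refine (Finset.card_insert_le _ _).trans ?_
      rw [SimpleGraph.card_neighborFinset_eq_degree, hv.degree_eq h1 (by omega)]
    · rw [pow_succ]
      exact Nat.mul_le_mul_right 4 (ih (by omega))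

end LocalTree

section WaveVectors

variable {W : Type*} {G : SimpleGraph W}

/-- The truncated profile `j ↦ 2^(-j/2)`, an approximate eigenfunction of the 3-regular tree. -/
noncomputable def waveProfile (r j : ℕ) : ℝ := if j ≤ r then (√2)⁻¹ ^ j else 0

lemma waveProfile_of_le {r j : ℕ} (h : j ≤ r) : waveProfile r j = (√2)⁻¹ ^ j := if_pos h

lemma waveProfile_of_lt {r j : ℕ} (h : r < j) : waveProfile r j = 0 := if_neg (by omega)

lemma two_pow_mul_inv_sqrt_pow (j k : ℕ) :
    (2 : ℝ) ^ j * ((√2)⁻¹ ^ j * (√2)⁻¹ ^ (j + k)) = (√2)⁻¹ ^ k := by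
  have h : (√2)⁻¹ * (√2)⁻¹ = (1 / 2 : ℝ) := by
    rw [← mul_inv, Real.mul_self_sqrt (by norm_num)]; norm_num
  rw [pow_add, ← mul_assoc ((√2)⁻¹ ^ j), ← mul_pow, h, ← mul_assoc, ← mul_pow]
  norm_num

lemma inv_sqrt_two_sq : (√2)⁻¹ ^ 2 = (1 / 2 : ℝ) := by
  rw [inv_pow, Real.sq_sqrt (by norm_num)]; norm_num

/-- The inner product of the vectors attached to two vertices. -/
noncomputable def waveInner [Fintype W] (G : SimpleGraph W) (r : ℕ) (v w : W) : ℝ :=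
  ∑ u, radial G (waveProfile r) v u * radial G (waveProfile r) w u

lemma waveInner_comm [Fintype W] (r : ℕ) (v w : W) :
    waveInner G r v w = waveInner G r w v := by
  simp only [waveInner, mul_comm]

variable [Fintype W] [DecidableEq W] [DecidableRel G.Adj]

lemma waveInner_self {R m : ℕ} {v w : W} (hv : IsLocalTree G R v) (hw : IsLocalTree G R w)
    (hvw : G.Adj v w) (hr : m + 2 < R) :
    waveInner G (m + 2) v v = 1 + 3 / 2 * ((m + 2 : ℕ) : ℝ) := by
  have h1 : waveInner G (m + 2) v v =
      ∑ u, radial G (fun j => waveProfile (m + 2) j * waveProfile (m + 2) j) v u *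
        radial G (fun _ => 1) w u := by
    refine Finset.sum_congr rfl fun u _ => ?_
    by_cases hu : G.Reachable v u
    · simp [radial, hu, hvw.symm.reachable.trans hu]
    · simp [radial, hu]
  rw [h1, sum_radial_mul_radial hv hw hvw hr
    (fun j hj => by rw [waveProfile_of_lt hj, zero_mul]), Finset.sum_range_succ]
  have h2 : ∀ j ∈ Finset.range (m + 2), (2 : ℝ) ^ j *
      (waveProfile (m + 2) j * waveProfile (m + 2) j * 1 +
        waveProfile (m + 2) (j + 1) * waveProfile (m + 2) (j + 1) * 1) = 3 / 2 := by
    intro j hj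
    rw [Finset.mem_range] at hj
    rw [waveProfile_of_le (by omega), waveProfile_of_le (by omega)]
    have h3 := two_pow_mul_inv_sqrt_pow j 0
    have h4 := two_pow_mul_inv_sqrt_pow j 2
    rw [inv_sqrt_two_sq] at h4
    rw [pow_zero, add_zero] at h3
    have h5 : (√2)⁻¹ ^ (j + 1) * (√2)⁻¹ ^ (j + 1) = (√2)⁻¹ ^ j * (√2)⁻¹ ^ (j + 2) := by ring
    rw [h5]
    linear_combination h3 + h4
  rw [Finset.sum_congr rfl h2, waveProfile_of_le le_rfl, waveProfile_of_lt (Nat.lt_succ_self _)]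
  have h3 := two_pow_mul_inv_sqrt_pow (m + 2) 0
  rw [pow_zero, add_zero] at h3
  simp only [Finset.sum_const, Finset.card_range, nsmul_eq_mul]
  linear_combination h3

lemma waveInner_adj {R m : ℕ} {v w : W} (hv : IsLocalTree G R v) (hw : IsLocalTree G R w)
    (hvw : G.Adj v w) (hr : m + 2 < R) :
    waveInner G (m + 2) v w = √2 * ((m + 2 : ℕ) : ℝ) := by
  rw [waveInner, sum_radial_mul_radial hv hw hvw hr (fun j hj => waveProfile_of_lt hj),
    Finset.sum_range_succ]
  have h2 : ∀ j ∈ Finset.range (m + 2), (2 : ℝ) ^ j *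
      (waveProfile (m + 2) j * waveProfile (m + 2) (j + 1) +
        waveProfile (m + 2) (j + 1) * waveProfile (m + 2) j) = √2 := by
    intro j hj
    rw [Finset.mem_range] at hj
    rw [waveProfile_of_le (by omega), waveProfile_of_le (by omega)]
    have h3 := two_pow_mul_inv_sqrt_pow j 1
    have h4 : 2 * (√2)⁻¹ ^ 1 = (√2 : ℝ) := by
      rw [pow_one, ← div_eq_mul_inv, Real.div_sqrt]
    linear_combination 2 * h3 + h4
  rw [Finset.sum_congr rfl h2, waveProfile_of_lt (Nat.lt_succ_self (m + 2))]
  simp [mul_comm]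

lemma sum_waveInner_neighbor {R m : ℕ} {v w : W} (hv : IsLocalTree G R v)
    (hw : IsLocalTree G R w) (hvw : G.Adj v w) (hr : m + 4 ≤ R) :
    ∑ y ∈ G.neighborFinset v, waveInner G (m + 2) w y = 4 * ((m + 2 : ℕ) : ℝ) - 1 / 2 := by
  have h1 : ∑ y ∈ G.neighborFinset v, waveInner G (m + 2) w y =
      ∑ u, radial G (waveProfile (m + 2)) w u *
        radial G (neighborProfile (waveProfile (m + 2))) v u := by
    simp only [waveInner]
    rw [Finset.sum_comm]
    refine Finset.sum_congr rfl fun u _ => ?_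
    rw [← Finset.mul_sum, sum_neighbor_radial hv hr fun j hj => waveProfile_of_lt hj]
  rw [h1, sum_radial_mul_radial hw hv hvw.symm (by omega) fun j hj => waveProfile_of_lt hj,
    Finset.sum_range_succ', Finset.sum_range_succ, Finset.sum_range_succ]
  simp only [neighborProfile]
  have h6 : ∀ j : ℕ, (2 : ℝ) ^ j * ((√2)⁻¹ ^ j * (√2)⁻¹ ^ j) = 1 :=
    fun j => two_pow_mul_inv_sqrt_pow j 0
  have h7 : ∀ j : ℕ, (2 : ℝ) ^ j * ((√2)⁻¹ ^ j * (√2)⁻¹ ^ (j + 2)) = 1 / 2 := fun j => by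
    rw [two_pow_mul_inv_sqrt_pow, inv_sqrt_two_sq]
  have h2 : ∀ j ∈ Finset.range m, (2 : ℝ) ^ (j + 1) *
      (waveProfile (m + 2) (j + 1) *
        (waveProfile (m + 2) (j + 1) + 2 * waveProfile (m + 2) (j + 1 + 2)) +
        waveProfile (m + 2) (j + 1 + 1) *
          (waveProfile (m + 2) j + 2 * waveProfile (m + 2) (j + 2))) = 4 := by
    intro j hj
    rw [Finset.mem_range] at hj
    rw [waveProfile_of_le (by omega), waveProfile_of_le (by omega), waveProfile_of_le (by omega),
      waveProfile_of_le (by omega)]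
    linear_combination h6 (j + 1) + 2 * h7 (j + 1) + 2 * h7 j + h6 (j + 2)
  rw [Finset.sum_congr rfl h2, waveProfile_of_le (j := m + 1) (by omega),
    waveProfile_of_lt (j := m + 1 + 2) (by omega), waveProfile_of_le (j := m + 1 + 1) (by omega),
    waveProfile_of_le (j := m) (by omega), waveProfile_of_lt (j := m + 2 + 2) (by omega),
    waveProfile_of_le (j := 0) (by omega), waveProfile_of_le (j := 0 + 2) (by omega),
    waveProfile_of_le (j := 0 + 1) (by omega)]
  simp only [Finset.sum_const, Finset.card_range, nsmul_eq_mul]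
  push_cast
  have h8 := inv_sqrt_two_sq
  linear_combination h6 (m + 1) + 2 * h7 m + h6 (m + 2) + h6 (m + 2) + 2 * h8 + 3 * h8

lemma exists_waveInner_eq {R m : ℕ} {v : W} (hv : IsLocalTree G R v)
    (hN : ∀ w, G.Adj v w → IsLocalTree G R w) (hr : m + 4 ≤ R) :
    ∃ a b, a ≠ b ∧ G.Adj v a ∧ G.Adj v b ∧
      waveInner G (m + 2) a b = (5 * ((m + 2 : ℕ) : ℝ) - 3) / 4 := by
  have hd : (G.neighborFinset v).card = 3 := by
    rw [SimpleGraph.card_neighborFinset_eq_degree]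
    exact hv.degree_eq (SimpleGraph.Reachable.refl _) (by simp; omega)
  obtain ⟨x, y, z, hxy, hxz, hyz, hxyz⟩ := Finset.card_eq_three.mp hd
  have hadj : ∀ w, G.Adj v w ↔ w = x ∨ w = y ∨ w = z := by
    intro w
    rw [← SimpleGraph.mem_neighborFinset, hxyz]
    simp
  have key : ∀ w, G.Adj v w → waveInner G (m + 2) w x + waveInner G (m + 2) w y +
      waveInner G (m + 2) w z = 4 * ((m + 2 : ℕ) : ℝ) - 1 / 2 := by
    intro w hw
    rw [← sum_waveInner_neighbor hv (hN w hw) hw hr, hxyz, Finset.sum_insert (by simp [hxy, hxz]),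
      Finset.sum_pair hyz, add_assoc]
  have hself : ∀ w, G.Adj v w → waveInner G (m + 2) w w = 1 + 3 / 2 * ((m + 2 : ℕ) : ℝ) :=
    fun w hw => waveInner_self (hN w hw) hv hw.symm (by omega)
  have hx := (hadj x).mpr (by simp)
  have hy := (hadj y).mpr (by simp)
  have hz := (hadj z).mpr (by simp)
  refine ⟨x, y, hxy, hx, hy, ?_⟩
  have h1 := key x hx
  have h2 := key y hy
  have h3 := key z hz
  rw [hself x hx] at h1
  rw [hself y hy, waveInner_comm _ y x] at h2
  rw [hself z hz, waveInner_comm _ z x, waveInner_comm _ z y] at h3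
  linarith

end WaveVectors

section Sheppard

open MeasureTheory

lemma measurable_real_sign : Measurable Real.sign :=
  Measurable.ite measurableSet_Iio measurable_const
    (Measurable.ite measurableSet_Ioi measurable_const measurable_const)

lemma abs_real_sign_le_one (x : ℝ) : |x.sign| ≤ 1 := by
  rcases Real.sign_apply_eq x with h | h | h <;> rw [h] <;> norm_num

lemma real_sign_mul_of_pos {c : ℝ} (hc : 0 < c) (x : ℝ) : (c * x).sign = x.sign := by
  rcases lt_trichotomy x 0 with h | h | h
  · rw [Real.sign_of_neg h, Real.sign_of_neg (mul_neg_of_pos_of_neg hc h)]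
  · rw [h, mul_zero]
  · rw [Real.sign_of_pos h, Real.sign_of_pos (mul_pos hc h)]

/-- A nonnegative function that is additive on `[0, 2c)` is linear on `[0, c]`. -/
lemma eq_div_of_additive {g : ℝ → ℝ} {c : ℝ} (hc : 0 < c)
    (hadd : ∀ s t, 0 ≤ s → 0 ≤ t → s + t < 2 * c → g (s + t) = g s + g t)
    (hg : ∀ t, 0 ≤ g t) (h1 : g c = 1) {t : ℝ} (ht0 : 0 ≤ t) (htc : t ≤ c) : g t = t / c := by
  have hmul : ∀ (h : ℝ), 0 ≤ h → ∀ n : ℕ, n * h < 2 * c → g (n * h) = n * g h := by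
    intro h hh n
    induction n with
    | zero =>
      intro _
      have := hadd 0 0 le_rfl le_rfl (by linarith)
      simp only [add_zero] at this
      simp only [Nat.cast_zero, zero_mul]
      linarith
    | succ n ih =>
      intro hn
      push_cast at hn ⊢
      have hnh : 0 ≤ (n : ℝ) * h := by positivity
      rw [add_mul, one_mul, hadd _ _ hnh hh (by linarith), ih (by linarith)]
      ring
  have hmono : ∀ s u, 0 ≤ s → s ≤ u → u < 2 * c → g s ≤ g u := by
    intro s u hs hsu hu
    have := hadd s (u - s) hs (by linarith) (by linarith)
    rw [add_sub_cancel] at this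
    linarith [hg (u - s)]
  have hgrid : ∀ N : ℕ, 2 ≤ N → |g t - t / c| ≤ 1 / N := by
    intro N hN
    have hN' : (2 : ℝ) ≤ N := by exact_mod_cast hN
    have hN0 : (0 : ℝ) < N := by linarith
    have hh : 0 < c / N := by positivity
    have hgh : g (c / N) = 1 / N := by
      have := hmul (c / N) hh.le N (by rw [mul_div_cancel₀ _ hN0.ne']; linarith)
      rw [mul_div_cancel₀ _ hN0.ne', h1] at this
      field_simp
      linarith
    set n := ⌊N * (t / c)⌋₊ with hn
    have hn1 : (n : ℝ) ≤ N * (t / c) := Nat.floor_le (by positivity)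
    have hn2 : N * (t / c) < n + 1 := Nat.lt_floor_add_one _
    have htc' : t / c ≤ 1 := (div_le_one hc).mpr htc
    have hnN : (n : ℝ) ≤ N := hn1.trans (mul_le_of_le_one_right hN0.le htc')
    have hlo : (n : ℝ) * (c / N) ≤ t := by
      calc (n : ℝ) * (c / N) ≤ N * (t / c) * (c / N) := by gcongr
        _ = t := by field_simp
    have hhi : t ≤ ((n + 1 : ℕ) : ℝ) * (c / N) := by
      push_cast
      calc t = N * (t / c) * (c / N) := by field_simp
        _ ≤ _ := by gcongr
    have hlt : ((n + 1 : ℕ) : ℝ) * (c / N) < 2 * c := by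
      push_cast
      rw [mul_div_assoc', div_lt_iff₀ hN0]
      nlinarith
    have e1 := hmono _ _ (by positivity) hlo (by linarith)
    have e2 := hmono _ _ ht0 hhi hlt
    rw [hmul _ hh.le _ (by linarith), hgh] at e1
    rw [hmul _ hh.le _ hlt, hgh] at e2
    push_cast at e2
    have e3 : (n : ℝ) * (1 / N) ≤ t / c := by
      rw [mul_one_div, div_le_iff₀ hN0]; linarith
    have e4 : t / c ≤ (n + 1) * (1 / N) := by
      rw [mul_one_div, le_div_iff₀ hN0]; linarith
    rw [abs_le]
    constructor <;> linarith
  by_contra hne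
  have hpos : 0 < |g t - t / c| := abs_pos.mpr (sub_ne_zero.mpr hne)
  obtain ⟨N, hN⟩ := exists_nat_gt (1 / |g t - t / c|)
  have h2 := hgrid (N + 2) (by omega)
  have hN' : 1 / |g t - t / c| < ((N + 2 : ℕ) : ℝ) := by push_cast; linarith
  have hN0 : (0 : ℝ) < ((N + 2 : ℕ) : ℝ) := by positivity
  rw [div_lt_comm₀ hpos hN0] at hN'
  linarith

variable {E : Type*} [NormedAddCommGroup E] [InnerProductSpace ℝ E]

/-- The point at angle `t` on the unit circle spanned by `a` and `b`. -/
noncomputable def circlePoint (a b : E) (t : ℝ) : E := Real.cos t • a + Real.sin t • b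

lemma inner_circlePoint {a b : E} (ha : ‖a‖ = 1) (hb : ‖b‖ = 1) (hab : inner ℝ a b = 0)
    (s t : ℝ) : inner ℝ (circlePoint a b s) (circlePoint a b t) = Real.cos (t - s) := by
  have hba : inner ℝ b a = 0 := by rw [real_inner_comm, hab]
  simp only [circlePoint, inner_add_left, inner_add_right, real_inner_smul_left,
    real_inner_smul_right, real_inner_self_eq_norm_sq, ha, hb, hab, hba, Real.cos_sub]
  ring

lemma exists_reflection_circlePoint {a b : E} (ha : ‖a‖ = 1) (hb : ‖b‖ = 1)
    (hab : inner ℝ a b = 0) (α : ℝ) :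
    ∃ T : E ≃ₗᵢ[ℝ] E, ∀ t, T (circlePoint a b t) = circlePoint a b (2 * α - t) := by
  set n := circlePoint a b (α + π / 2) with hn
  have hnn : ‖n‖ = 1 := by
    have := inner_circlePoint ha hb hab (α + π / 2) (α + π / 2)
    rw [sub_self, Real.cos_zero, real_inner_self_eq_norm_sq] at this
    exact (pow_eq_one_iff_of_nonneg (norm_nonneg _) two_ne_zero).mp this
  refine ⟨(ℝ ∙ n)ᗮ.reflection, fun t => ?_⟩
  rw [Submodule.reflection_orthogonal_apply, Submodule.reflection_singleton_apply, hnn,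
    inner_circlePoint ha hb hab]
  have h1 : Real.cos (t - (α + π / 2)) = Real.sin (t - α) := by
    rw [← sub_sub, Real.cos_sub_pi_div_two]
  rw [h1, hn]
  simp only [circlePoint, Real.cos_add_pi_div_two, Real.sin_add_pi_div_two, smul_add, smul_smul]
  have h2 : Real.cos (2 * α - t) = Real.cos t + 2 * Real.sin (t - α) * Real.sin α := by
    rw [Real.sin_sub, Real.cos_sub, Real.cos_two_mul, Real.sin_two_mul]
    linear_combination (2 * Real.cos t) * Real.sin_sq_add_cos_sq α
  have h3 : Real.sin (2 * α - t) = Real.sin t - 2 * Real.sin (t - α) * Real.cos α := by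
    rw [Real.sin_sub, Real.sin_sub, Real.cos_two_mul, Real.sin_two_mul]
    ring
  rw [h2, h3]
  simp only [RCLike.ofReal_one, one_pow, div_one]
  module

variable [MeasurableSpace E]

/-- A rotation-invariant measure that does not charge hyperplanes. -/
structure IsRotationInvariant (μ : Measure E) : Prop where
  measurePreserving : ∀ T : E ≃ₗᵢ[ℝ] E, MeasurePreserving T μ μ
  ae_inner_ne_zero : ∀ x : E, x ≠ 0 → ∀ᵐ z ∂μ, inner ℝ x z ≠ 0

/-- The correlation of the signs of the projections to two directions. -/
noncomputable def signCorr (μ : Measure E) (x y : E) : ℝ :=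
  ∫ z, (inner ℝ x z).sign * (inner ℝ y z).sign ∂μ

variable {μ : Measure E}

lemma signCorr_comm (x y : E) : signCorr μ x y = signCorr μ y x := by
  simp only [signCorr, mul_comm]

lemma signCorr_neg_right (x y : E) : signCorr μ x (-y) = -signCorr μ x y := by
  simp only [signCorr, inner_neg_left, Real.sign_neg, mul_neg, integral_neg]

lemma signCorr_smul {c : ℝ} (hc : 0 < c) (x y : E) :
    signCorr μ (c • x) (c • y) = signCorr μ x y := by
  simp only [signCorr, real_inner_smul_left, real_sign_mul_of_pos hc]

variable [BorelSpace E]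

lemma measurable_sign_inner (x : E) : Measurable fun z : E => (inner ℝ x z).sign :=
  measurable_real_sign.comp (continuous_const.inner continuous_id).measurable

lemma IsRotationInvariant.integral_comp (hμ : IsRotationInvariant μ) (T : E ≃ₗᵢ[ℝ] E)
    (f : E → ℝ) : ∫ z, f (T z) ∂μ = ∫ z, f z ∂μ :=
  (hμ.measurePreserving T).integral_comp T.toHomeomorph.measurableEmbedding f

lemma signCorr_map (hμ : IsRotationInvariant μ) (T : E ≃ₗᵢ[ℝ] E) (x y : E) :
    signCorr μ (T x) (T y) = signCorr μ x y := by
  rw [signCorr, ← hμ.integral_comp T]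
  simp only [T.inner_map_map, signCorr]

lemma integrable_sign_mul_sign [IsFiniteMeasure μ] (x y : E) :
    Integrable (fun z => (inner ℝ x z).sign * (inner ℝ y z).sign) μ := by
  refine Integrable.of_bound
    ((measurable_sign_inner x).mul (measurable_sign_inner y)).aestronglyMeasurable 1 ?_
  refine Filter.Eventually.of_forall fun z => ?_
  rw [Real.norm_eq_abs, abs_mul]
  exact mul_le_one₀ (abs_real_sign_le_one _) (abs_nonneg _) (abs_real_sign_le_one _)

lemma signCorr_circlePoint_shift (hμ : IsRotationInvariant μ) {a b : E} (ha : ‖a‖ = 1)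
    (hb : ‖b‖ = 1) (hab : inner ℝ a b = 0) (s t : ℝ) :
    signCorr μ (circlePoint a b s) (circlePoint a b (s + t)) =
      signCorr μ (circlePoint a b 0) (circlePoint a b t) := by
  obtain ⟨T, hT⟩ := exists_reflection_circlePoint ha hb hab ((s + t) / 2)
  rw [← signCorr_map hμ T, hT, hT, signCorr_comm]
  congr 2 <;> ring

lemma signCorr_circlePoint_pi_div_two (hμ : IsRotationInvariant μ) {a b : E} (ha : ‖a‖ = 1)
    (hb : ‖b‖ = 1) (hab : inner ℝ a b = 0) :
    signCorr μ (circlePoint a b 0) (circlePoint a b (π / 2)) = 0 := by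
  obtain ⟨T, hT⟩ := exists_reflection_circlePoint ha hb hab 0
  have h1 := signCorr_map hμ T (circlePoint a b 0) (circlePoint a b (π / 2))
  have h2 : circlePoint a b (2 * 0 - π / 2) = -circlePoint a b (π / 2) := by
    simp [circlePoint]
  rw [hT, hT, h2, signCorr_neg_right] at h1
  norm_num at h1
  linarith

lemma sign_triangle {p q w A B C : ℝ} (hp : p ≠ 0) (hq : q ≠ 0) (hw : w ≠ 0) (hA : 0 < A)
    (hB : 0 ≤ B) (hC : 0 ≤ C) (h : A * q = B * p + C * w) :
    1 - p.sign * w.sign = (1 - p.sign * q.sign) + (1 - q.sign * w.sign) := by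
  rcases hp.lt_or_gt with hp | hp <;> rcases hq.lt_or_gt with hq | hq <;>
    rcases hw.lt_or_gt with hw | hw <;>
    simp only [Real.sign_of_neg, Real.sign_of_pos, hp, hq, hw] <;> norm_num
  · nlinarith [mul_pos hA hq, mul_nonneg hB (neg_nonneg.mpr hp.le),
      mul_nonneg hC (neg_nonneg.mpr hw.le)]
  · nlinarith [mul_pos hA (neg_pos.mpr hq), mul_nonneg hB hp.le, mul_nonneg hC hw.le]

lemma signCorr_circlePoint (hμ : IsRotationInvariant μ) [IsProbabilityMeasure μ] {a b : E}
    (ha : ‖a‖ = 1) (hb : ‖b‖ = 1) (hab : inner ℝ a b = 0) {t : ℝ} (ht0 : 0 ≤ t)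
    (ht : t ≤ π / 2) :
    signCorr μ (circlePoint a b 0) (circlePoint a b t) = 1 - t / (π / 2) := by
  have hne : ∀ u, ∀ᵐ z ∂μ, inner ℝ (circlePoint a b u) z ≠ 0 := by
    refine fun u => hμ.ae_inner_ne_zero _ fun h => ?_
    have := inner_circlePoint ha hb hab u u
    rw [h, inner_zero_left, sub_self, Real.cos_zero] at this
    exact zero_ne_one this
  have hint' : ∀ x y : E,
      Integrable (fun z => 1 - (inner ℝ x z).sign * (inner ℝ y z).sign) μ :=
    fun x y => (integrable_const _).sub (integrable_sign_mul_sign _ _)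
  have hint : ∀ x y : E, ∫ z, (1 - (inner ℝ x z).sign * (inner ℝ y z).sign) ∂μ =
      1 - signCorr μ x y := by
    intro x y
    rw [integral_sub (integrable_const _) (integrable_sign_mul_sign x y)]
    simp [signCorr]
  have key := eq_div_of_additive
    (g := fun u => 1 - signCorr μ (circlePoint a b 0) (circlePoint a b u))
    (c := π / 2) (by positivity) ?_ ?_ ?_ ht0 ht
  · linarith
  · intro s u hs hu hsu
    rcases (add_nonneg hs hu).eq_or_lt with h0 | h0
    · obtain rfl : s = 0 := by linarith
      obtain rfl : u = 0 := by linarith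
      have h1 : ∫ z, (1 - (inner ℝ (circlePoint a b 0) z).sign *
          (inner ℝ (circlePoint a b 0) z).sign) ∂μ = 0 := by
        refine integral_eq_zero_of_ae ?_
        filter_upwards [hne 0] with z hz
        rcases Real.sign_apply_eq_of_ne_zero _ hz with h | h <;> simp [h]
      rw [hint] at h1
      simp [h1]
    · rw [← signCorr_circlePoint_shift hμ ha hb hab s u, ← hint, ← hint, ← hint,
        ← integral_add (hint' _ _) (hint' _ _)]
      refine integral_congr_ae ?_
      filter_upwards [hne 0, hne s, hne (s + u)] with z h1 h2 h3
      refine sign_triangle h1 h2 h3 (A := Real.sin (s + u)) (B := Real.sin u) (C := Real.sin s)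
        (Real.sin_pos_of_pos_of_lt_pi h0 (by linarith))
        (Real.sin_nonneg_of_nonneg_of_le_pi hu (by linarith))
        (Real.sin_nonneg_of_nonneg_of_le_pi hs (by linarith)) ?_
      simp only [circlePoint, inner_add_left, real_inner_smul_left, Real.cos_zero, Real.sin_zero,
        Real.sin_add, Real.cos_add]
      linear_combination (Real.sin u * inner ℝ a z) * Real.sin_sq_add_cos_sq s
  · intro u
    rw [← hint]
    refine integral_nonneg fun z => ?_
    have h1 := mul_le_one₀ (abs_real_sign_le_one (inner ℝ (circlePoint a b 0) z)) (abs_nonneg _)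
      (abs_real_sign_le_one (inner ℝ (circlePoint a b u) z))
    rw [← abs_mul] at h1
    simp only [Pi.zero_apply]
    linarith [le_abs_self ((inner ℝ (circlePoint a b 0) z).sign *
      (inner ℝ (circlePoint a b u) z).sign)]
  · rw [signCorr_circlePoint_pi_div_two hμ ha hb hab, sub_zero]

/-- Sheppard's formula. -/
lemma signCorr_eq (hμ : IsRotationInvariant μ) [IsProbabilityMeasure μ] {x y : E} {N M : ℝ}
    (hx : inner ℝ x x = N) (hy : inner ℝ y y = N) (hxy : inner ℝ x y = M) (hM : 0 ≤ M)
    (hMN : M < N) : signCorr μ x y = 1 - 2 * Real.arccos (M / N) / π := by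
  have hN : 0 < N := hM.trans_lt hMN
  set t := Real.arccos (M / N) with ht
  have hMN1 : M / N < 1 := (div_lt_one hN).mpr hMN
  have hcos : Real.cos t = M / N :=
    Real.cos_arccos (by linarith [div_nonneg hM hN.le]) hMN1.le
  have ht0 : 0 < t := Real.arccos_pos.mpr hMN1
  have ht2 : t ≤ π / 2 := Real.arccos_le_pi_div_two.mpr (div_nonneg hM hN.le)
  have hsin : 0 < Real.sin t := Real.sin_pos_of_pos_of_lt_pi ht0 (by linarith [Real.pi_pos])
  set c := (√N)⁻¹ with hc
  have hc0 : 0 < c := by positivity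
  have hcN : c * c * N = 1 := by
    rw [hc, ← mul_inv, Real.mul_self_sqrt hN.le, inv_mul_cancel₀ hN.ne']
  have hcM : c * c * M = Real.cos t := by
    rw [hcos, eq_div_iff hN.ne']
    linear_combination M * hcN
  obtain ⟨a, ha'⟩ : ∃ a, a = c • x := ⟨_, rfl⟩
  obtain ⟨d, hd'⟩ : ∃ d, d = c • y := ⟨_, rfl⟩
  have haa : inner ℝ a a = (1 : ℝ) := by
    rw [ha', real_inner_smul_left, real_inner_smul_right, hx, ← hcN]; ring
  have had : inner ℝ a d = Real.cos t := by
    rw [ha', hd', real_inner_smul_left, real_inner_smul_right, hxy, ← hcM]; ring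
  have hdd : inner ℝ d d = (1 : ℝ) := by
    rw [hd', real_inner_smul_left, real_inner_smul_right, hy, ← hcN]; ring
  have hda : inner ℝ d a = Real.cos t := by rw [real_inner_comm, had]
  obtain ⟨b, hb'⟩ : ∃ b, b = (Real.sin t)⁻¹ • (d - Real.cos t • a) := ⟨_, rfl⟩
  have hab : inner ℝ a b = (0 : ℝ) := by
    rw [hb', real_inner_smul_right, inner_sub_right, had, real_inner_smul_right, haa]
    ring
  have hbb : inner ℝ b b = (1 : ℝ) := by
    simp only [hb', real_inner_smul_right, real_inner_smul_left, inner_sub_right, inner_sub_left,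
      hdd, had, hda, haa]
    field_simp
    linear_combination -Real.sin_sq_add_cos_sq t
  have hna : ‖a‖ = 1 := by
    rw [real_inner_self_eq_norm_sq] at haa
    exact (pow_eq_one_iff_of_nonneg (norm_nonneg _) two_ne_zero).mp haa
  have hnb : ‖b‖ = 1 := by
    rw [real_inner_self_eq_norm_sq] at hbb
    exact (pow_eq_one_iff_of_nonneg (norm_nonneg _) two_ne_zero).mp hbb
  have h0 : circlePoint a b 0 = c • x := by simp [circlePoint, ha']
  have h1 : circlePoint a b t = c • y := by
    rw [circlePoint, hb', smul_smul, mul_inv_cancel₀ hsin.ne', one_smul, hd']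
    abel
  have := signCorr_circlePoint hμ hna hnb hab ht0.le ht2
  rw [h0, h1, signCorr_smul hc0] at this
  rw [this]
  field_simp

end Sheppard

section UniformBall

open MeasureTheory

variable (E : Type*) [NormedAddCommGroup E] [InnerProductSpace ℝ E] [FiniteDimensional ℝ E]
  [MeasurableSpace E] [BorelSpace E]

/-- Every finite-dimensional inner product space carries a rotation-invariant probability
measure, such as the uniform measure on the unit ball. -/
lemma exists_isRotationInvariant :
    ∃ μ : Measure E, IsProbabilityMeasure μ ∧ IsRotationInvariant μ := by
  set B : Set E := Metric.ball 0 1 with hB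
  have hB0 : (volume : Measure E) B ≠ 0 := (Metric.measure_ball_pos volume 0 one_pos).ne'
  have hBf : (volume : Measure E) B ≠ ⊤ := measure_ball_lt_top.ne
  refine ⟨ProbabilityTheory.cond volume B,
    ProbabilityTheory.cond_isProbabilityMeasure_of_finite hB0 hBf, fun T => ?_, fun x hx => ?_⟩
  · have h := (T.measurePreserving.restrict_preimage_emb
      T.toHomeomorph.measurableEmbedding B).smul_measure (volume B)⁻¹
    have hpre : T ⁻¹' B = B := by
      ext z
      simp [hB]
    rw [hpre] at h
    exact h
  · have h1 := Measure.addHaar_submodule (volume : Measure E) (ℝ ∙ x)ᗮ ?_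
    · have h2 : ∀ᵐ z ∂(volume : Measure E), inner ℝ x z ≠ 0 := by
        rw [ae_iff]
        convert h1 using 2
        ext z
        simp [Submodule.mem_orthogonal_singleton_iff_inner_right]
      exact ProbabilityTheory.cond_absolutelyContinuous.ae_le h2
    · intro h
      have : x ∈ (ℝ ∙ x)ᗮ := h ▸ Submodule.mem_top
      rw [Submodule.mem_orthogonal_singleton_iff_inner_right, inner_self_eq_zero] at this
      exact hx this

end UniformBall

section OddLocal

open MeasureTheory

variable {W : Type*} {G : SimpleGraph W}

/-- The vector attached to a vertex. -/
noncomputable def waveVector (G : SimpleGraph W) (r : ℕ) (v : W) : EuclideanSpace ℝ W :=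
  WithLp.toLp 2 (radial G (waveProfile r) v)

lemma waveVector_ne_zero (r : ℕ) (v : W) : waveVector G r v ≠ 0 := by
  intro h
  have h1 : waveVector G r v v = 0 := by rw [h]; rfl
  simp [waveVector, radial, waveProfile] at h1

variable [Fintype W]

open scoped Classical in
/-- The isometry changing the sign of the coordinates in `B`. -/
noncomputable def flipOn (B : Finset W) : EuclideanSpace ℝ W ≃ₗᵢ[ℝ] EuclideanSpace ℝ W :=
  LinearIsometryEquiv.piLpCongrRight 2 fun u =>
    if u ∈ B then LinearIsometryEquiv.neg ℝ else LinearIsometryEquiv.refl ℝ ℝ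

lemma flipOn_apply_of_mem {B : Finset W} {u : W} (h : u ∈ B) (z : EuclideanSpace ℝ W) :
    flipOn B z u = -z u := by
  simp [flipOn, h]

lemma flipOn_apply_of_notMem {B : Finset W} {u : W} (h : u ∉ B) (z : EuclideanSpace ℝ W) :
    flipOn B z u = z u := by
  simp [flipOn, h]

/-- A bounded function of the coordinates in the ball of radius `m` about `v` that is odd in
these coordinates. -/
structure IsOddLocal (G : SimpleGraph W) (m : ℕ) (v : W) (F : EuclideanSpace ℝ W → ℝ) :
    Prop where
  measurable : Measurable F
  abs_le_one : ∀ z, |F z| ≤ 1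
  odd : ∀ B : Finset W, distBall G v m ⊆ B → ∀ z, F (flipOn B z) = -F z
  fixed : ∀ B : Finset W, Disjoint (distBall G v m) B → ∀ z, F (flipOn B z) = F z

variable {μ : Measure (EuclideanSpace ℝ W)}

lemma IsOddLocal.integrable_mul [IsFiniteMeasure μ] {m : ℕ} {v w : W}
    {F F' : EuclideanSpace ℝ W → ℝ} (hF : IsOddLocal G m v F) (hF' : IsOddLocal G m w F') :
    Integrable (fun z => F z * F' z) μ := by
  refine Integrable.of_bound (hF.measurable.mul hF'.measurable).aestronglyMeasurable 1 ?_
  refine Filter.Eventually.of_forall fun z => ?_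
  rw [Real.norm_eq_abs, abs_mul]
  exact mul_le_one₀ (hF.abs_le_one z) (abs_nonneg _) (hF'.abs_le_one z)

lemma IsOddLocal.integral_mul_le_one [IsProbabilityMeasure μ] {m : ℕ} {v w : W}
    {F F' : EuclideanSpace ℝ W → ℝ} (hF : IsOddLocal G m v F) (hF' : IsOddLocal G m w F') :
    ∫ z, F z * F' z ∂μ ≤ 1 := by
  calc ∫ z, F z * F' z ∂μ ≤ ∫ _, (1 : ℝ) ∂μ := by
        refine integral_mono (hF.integrable_mul hF') (integrable_const _) fun z => ?_
        refine (le_abs_self _).trans ?_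
        rw [abs_mul]
        exact mul_le_one₀ (hF.abs_le_one z) (abs_nonneg _) (hF'.abs_le_one z)
    _ = 1 := by simp

lemma IsOddLocal.integral_mul_eq_zero (hμ : IsRotationInvariant μ) {m : ℕ} {v w : W}
    {F F' : EuclideanSpace ℝ W → ℝ} (hF : IsOddLocal G m v F) (hF' : IsOddLocal G m w F')
    (h : w ∉ distBall G v (2 * m)) : ∫ z, F z * F' z ∂μ = 0 := by
  have hdisj : Disjoint (distBall G v m) (distBall G w m) := by
    rw [Finset.disjoint_left]
    intro u hu hu'
    rw [mem_distBall] at hu hu'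
    refine h (mem_distBall.mpr ⟨hu.1.trans hu'.1.symm, ?_⟩)
    have := hu.1.dist_triangle_left w
    rw [G.dist_comm (u := u)] at this
    omega
  have h1 := hμ.integral_comp (flipOn (distBall G w m)) fun z => F z * F' z
  simp only [hF.fixed _ hdisj, hF'.odd _ subset_rfl, mul_neg, integral_neg] at h1
  linarith

/-- Second moment bound: distant terms are uncorrelated. -/
lemma integral_sum_sq_le (hμ : IsRotationInvariant μ) [IsProbabilityMeasure μ] {m R : ℕ}
    {T : Finset W} (hT : ∀ v ∈ T, IsLocalTree G R v) (hR : 2 * m ≤ R)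
    {F : W → EuclideanSpace ℝ W → ℝ} (hF : ∀ v ∈ T, IsOddLocal G m v (F v)) :
    Integrable (fun z => (∑ v ∈ T, F v z) ^ 2) μ ∧
      ∫ z, (∑ v ∈ T, F v z) ^ 2 ∂μ ≤ T.card * 4 ^ (2 * m) := by
  classical
  have hint : ∀ v ∈ T, Integrable (fun z => ∑ w ∈ T, F v z * F w z) μ := fun v hv =>
    integrable_finsetSum _ fun w hw => (hF v hv).integrable_mul (hF w hw)
  have heq : (fun z => (∑ v ∈ T, F v z) ^ 2) =
      fun z => ∑ v ∈ T, ∑ w ∈ T, F v z * F w z := by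
    ext z
    rw [sq, Finset.sum_mul_sum]
  rw [heq]
  refine ⟨integrable_finsetSum _ hint, ?_⟩
  rw [integral_finsetSum _ hint, ← nsmul_eq_mul]
  refine Finset.sum_le_card_nsmul _ _ _ fun v hv => ?_
  rw [integral_finsetSum _ fun w hw => (hF v hv).integrable_mul (hF w hw)]
  have hterm : ∀ w ∈ T, ∫ z, F v z * F w z ∂μ ≤
      if w ∈ distBall G v (2 * m) then 1 else 0 := by
    intro w hw
    split_ifs with h
    · exact (hF v hv).integral_mul_le_one (hF w hw)
    · exact ((hF v hv).integral_mul_eq_zero hμ (hF w hw) h).le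
  refine (Finset.sum_le_sum hterm).trans ?_
  rw [← Finset.sum_filter, Finset.sum_const, nsmul_eq_mul, mul_one]
  have h1 : (T.filter (· ∈ distBall G v (2 * m))).card ≤ 4 ^ (2 * m) :=
    (Finset.card_le_card fun x hx => (Finset.mem_filter.mp hx).2).trans
      (card_distBall_le (hT v hv) _ hR)
  exact_mod_cast h1

/-- The random sign attached to a vertex. -/
noncomputable def waveSign (G : SimpleGraph W) (r : ℕ) (v : W) (z : EuclideanSpace ℝ W) : ℝ :=
  (inner ℝ (waveVector G r v) z).sign

lemma inner_waveVector (r : ℕ) (v w : W) :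
    inner ℝ (waveVector G r v) (waveVector G r w) = waveInner G r v w := by
  simp [waveVector, waveInner, PiLp.inner_apply, mul_comm]

lemma isOddLocal_waveSign (r : ℕ) {m : ℕ} {v w : W}
    (h : ∀ u, G.Reachable w u → G.dist w u ≤ r → u ∈ distBall G v m) :
    IsOddLocal G m v (waveSign G r w) := by
  have hsupp : ∀ u, u ∉ distBall G v m → waveVector G r w u = 0 := by
    intro u hu
    simp only [waveVector, radial]
    split_ifs with hr
    · exact waveProfile_of_lt (by by_contra hc; exact hu (h u hr (by omega)))
    · rfl
  refine ⟨measurable_sign_inner _, fun z => abs_real_sign_le_one _, fun B hB z => ?_,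
    fun B hB z => ?_⟩
  · rw [waveSign, waveSign, ← Real.sign_neg, ← inner_neg_right]
    congr 1
    rw [PiLp.inner_apply, PiLp.inner_apply]
    refine Finset.sum_congr rfl fun u _ => ?_
    by_cases hu : u ∈ B
    · rw [flipOn_apply_of_mem hu, PiLp.neg_apply]
    · rw [hsupp u fun h => hu (hB h), inner_zero_left, inner_zero_left]
  · rw [waveSign, waveSign]
    congr 1
    rw [PiLp.inner_apply, PiLp.inner_apply]
    refine Finset.sum_congr rfl fun u _ => ?_
    by_cases hu : u ∈ B
    · rw [hsupp u (Finset.disjoint_right.mp hB hu), inner_zero_left, inner_zero_left]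
    · rw [flipOn_apply_of_notMem hu]

lemma isOddLocal_waveSign_self (r : ℕ) (v : W) : IsOddLocal G (r + 1) v (waveSign G r v) :=
  isOddLocal_waveSign r fun _ h1 h2 => mem_distBall.mpr ⟨h1, by omega⟩

lemma isOddLocal_waveSign_adj (r : ℕ) {v w : W} (h : G.Adj v w) :
    IsOddLocal G (r + 1) v (waveSign G r w) :=
  isOddLocal_waveSign r fun _ h1 h2 => by
    obtain ⟨h3, h4, -⟩ := adj_dist_bounds h.symm h1
    exact mem_distBall.mpr ⟨h3, by omega⟩

lemma abs_one_sub_mul_le_two {a b : ℝ} (ha : |a| ≤ 1) (hb : |b| ≤ 1) : |1 - a * b| ≤ 2 := by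
  have h1 := mul_le_one₀ ha (abs_nonneg _) hb
  have h2 := abs_sub (1 : ℝ) (a * b)
  rw [abs_one, abs_mul] at h2
  linarith

lemma IsOddLocal.mul_disagree {m : ℕ} {v : W} {f g h : EuclideanSpace ℝ W → ℝ}
    (hf : IsOddLocal G m v f) (hg : IsOddLocal G m v g) (hh : IsOddLocal G m v h) :
    IsOddLocal G m v fun z => f z * ((1 - f z * g z) * (1 - f z * h z) / 4) := by
  refine ⟨?_, fun z => ?_, fun B hB z => ?_, fun B hB z => ?_⟩
  · exact hf.measurable.mul ((((hf.measurable.mul hg.measurable).const_sub 1).mul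
      ((hf.measurable.mul hh.measurable).const_sub 1)).div_const 4)
  · have h1 := abs_one_sub_mul_le_two (hf.abs_le_one z) (hg.abs_le_one z)
    have h2 := abs_one_sub_mul_le_two (hf.abs_le_one z) (hh.abs_le_one z)
    have h3 := mul_le_mul h1 h2 (abs_nonneg _) zero_le_two
    rw [abs_mul, abs_div, abs_mul, abs_of_pos (four_pos : (0 : ℝ) < 4)]
    exact mul_le_one₀ (hf.abs_le_one z) (by positivity) (by linarith)
  · simp only [hf.odd B hB, hg.odd B hB, hh.odd B hB]
    ring
  · simp only [hf.fixed B hB, hg.fixed B hB, hh.fixed B hB]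

end OddLocal

section FiniteBound

open MeasureTheory

/-- The angle between the vectors of adjacent vertices. -/
noncomputable def neighborAngle (r : ℕ) : ℝ := Real.arccos (√2 * r / (1 + 3 / 2 * r))

/-- The angle between the vectors of two suitable neighbours of a vertex. -/
noncomputable def siblingAngle (r : ℕ) : ℝ := Real.arccos ((5 * r - 3) / 4 / (1 + 3 / 2 * r))

variable {W : Type*} [Fintype W] {G : SimpleGraph W}

lemma signCorr_waveVector {μ : Measure (EuclideanSpace ℝ W)} (hμ : IsRotationInvariant μ)
    [IsProbabilityMeasure μ] {r : ℕ} {v w : W} {N M : ℝ} (hv : waveInner G r v v = N)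
    (hw : waveInner G r w w = N) (hvw : waveInner G r v w = M) (hM : 0 ≤ M) (hMN : M < N) :
    ∫ z, waveSign G r v z * waveSign G r w z ∂μ = 1 - 2 * Real.arccos (M / N) / π :=
  signCorr_eq hμ (by rw [inner_waveVector, hv]) (by rw [inner_waveVector, hw])
    (by rw [inner_waveVector, hvw]) hM hMN

variable [DecidableEq W] [DecidableRel G.Adj]

lemma cutValue_le {s : W → ℝ} (hs : ∀ x, s x = 1 ∨ s x = -1) {T : Finset W}
    (hT : ∀ v ∈ T, G.degree v = 3) :
    cutValue G s ≤ ∑ v ∈ T, (3 / 4 - (∑ y ∈ G.neighborFinset v, s v * s y) / 4) +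
      (2 * (G.edgeSet.ncard : ℝ) - 3 * T.card) / 2 := by
  have h1 : ∀ x, (∑ y, if G.Adj x y then 1 - s x * s y else 0) =
      ∑ y ∈ G.neighborFinset x, (1 - s x * s y) := fun x => by
    rw [G.neighborFinset_eq_filter, Finset.sum_filter]
  have h2 : ∀ x, ∑ y ∈ G.neighborFinset x, (1 - s x * s y) ≤ 2 * (G.degree x : ℝ) := by
    intro x
    calc _ ≤ ∑ y ∈ G.neighborFinset x, (2 : ℝ) := Finset.sum_le_sum fun y _ => by
          rcases hs x with h | h <;> rcases hs y with h' | h' <;> rw [h, h'] <;> norm_num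
      _ = _ := by simp [mul_comm]
  have h3 : (∑ x, (G.degree x : ℝ)) = 2 * (G.edgeSet.ncard : ℝ) := by
    have := G.sum_degrees_eq_twice_card_edges
    rw [← SimpleGraph.coe_edgeFinset, Set.ncard_coe_finset]
    exact_mod_cast this
  have h4 : ∑ x ∈ Tᶜ, (G.degree x : ℝ) = 2 * (G.edgeSet.ncard : ℝ) - 3 * T.card := by
    have h5 : ∑ x ∈ T, (G.degree x : ℝ) = 3 * T.card := by
      rw [Finset.sum_congr rfl fun v hv => congrArg Nat.cast (hT v hv)]
      simp [mul_comm]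
    rw [← h3, ← h5, ← Finset.sum_add_sum_compl T, add_sub_cancel_left]
  rw [cutValue]
  simp only [h1]
  rw [← Finset.sum_add_sum_compl T, add_div]
  refine add_le_add (le_of_eq ?_) ?_
  · rw [Finset.sum_div]
    refine Finset.sum_congr rfl fun v hv => ?_
    rw [Finset.sum_sub_distrib, Finset.sum_const, SimpleGraph.card_neighborFinset_eq_degree,
      hT v hv]
    simp
    ring
  · have := Finset.sum_le_sum fun x (_ : x ∈ Tᶜ) => h2 x
    rw [← Finset.mul_sum, h4] at this
    linarith

lemma abs_le_sq_div_add {x q : ℝ} (hq : 0 < q) : |x| ≤ (x ^ 2 / q + q) / 2 := by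
  rw [le_div_iff₀ two_pos, div_add' _ _ _ hq.ne', le_div_iff₀ hq, ← sq_abs]
  nlinarith [sq_nonneg (|x| - q)]

/-- A small bisection of a graph most of whose vertices look like the 3-regular tree. -/
lemma exists_small_bisection [Nonempty W] {m R : ℕ} (hR : 2 * m + 6 ≤ R) {T : Finset W}
    (hTc : 2 * Tᶜ.card ≤ Fintype.card W) (hT : ∀ v ∈ T, IsLocalTree G R v)
    (hTN : ∀ v ∈ T, ∀ w, G.Adj v w → IsLocalTree G R w) :
    ∃ S : Set W, IsBisection S ∧ (bisectionSize G S : ℝ) ≤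
      T.card * (3 * neighborAngle (m + 2) / (2 * π) -
        (2 * neighborAngle (m + 2) - siblingAngle (m + 2)) / (16 * π)) +
      (2 * (G.edgeSet.ncard : ℝ) - 3 * T.card) / 2 + 3 / 2 * Tᶜ.card + 2 +
      (4 ^ (2 * m + 6) + 1) * √(Fintype.card W) := by
  obtain ⟨μ, hprob, hμ⟩ := exists_isRotationInvariant (EuclideanSpace ℝ W)
  set r := m + 2 with hr
  have hr2 : (2 : ℝ) ≤ r := by rw [hr]; push_cast; linarith [(Nat.cast_nonneg m : (0 : ℝ) ≤ m)]
  have hsq2 : (√2 : ℝ) < 3 / 2 := by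
    rw [Real.sqrt_lt' (by norm_num)]; norm_num
  have hdeg : ∀ v ∈ T, G.degree v = 3 := fun v hv =>
    (hT v hv).degree_eq (SimpleGraph.Reachable.refl _) (by simp; omega)
  have hnorm : ∀ v ∈ T, ∀ w, G.Adj v w → waveInner G r v v = 1 + 3 / 2 * r ∧
      waveInner G r w w = 1 + 3 / 2 * r := fun v hv w hw =>
    ⟨waveInner_self (hT v hv) (hTN v hv w hw) hw (by omega),
      waveInner_self (hTN v hv w hw) (hT v hv) hw.symm (by omega)⟩
  have hcorr : ∀ v ∈ T, ∀ w, G.Adj v w →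
      ∫ z, waveSign G r v z * waveSign G r w z ∂μ = 1 - 2 * neighborAngle r / π :=
    fun v hv w hw => signCorr_waveVector hμ (hnorm v hv w hw).1 (hnorm v hv w hw).2
      (waveInner_adj (hT v hv) (hTN v hv w hw) hw (by omega)) (by positivity) (by nlinarith)
  choose! a b hab hva hvb hab' using fun v hv =>
    exists_waveInner_eq (m := m) (hT v hv) (hTN v hv) (by omega)
  have hcorr' : ∀ v ∈ T, ∫ z, waveSign G r (a v) z * waveSign G r (b v) z ∂μ =
      1 - 2 * siblingAngle r / π := fun v hv =>
    signCorr_waveVector hμ (hnorm v hv _ (hva v hv)).2 (hnorm v hv _ (hvb v hv)).2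
      (hab' v hv) (by linarith) (by linarith)
  have hint : ∀ v w, Integrable (fun z => waveSign G r v z * waveSign G r w z) μ :=
    fun v w => integrable_sign_mul_sign _ _
  set ℓ : W → EuclideanSpace ℝ W → ℝ := fun v z =>
    (3 / 4 - (∑ y ∈ G.neighborFinset v, waveSign G r v z * waveSign G r y z) / 4) -
      (1 - waveSign G r v z * waveSign G r (a v) z - waveSign G r v z * waveSign G r (b v) z +
        waveSign G r (a v) z * waveSign G r (b v) z) / 32 with hℓ
  have hℓ1 : ∀ v, Integrable (fun z =>
      3 / 4 - (∑ y ∈ G.neighborFinset v, waveSign G r v z * waveSign G r y z) / 4) μ := fun v =>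
    (integrable_const _).sub ((integrable_finsetSum _ fun y _ => hint v y).div_const 4)
  have hℓ2 : ∀ v, Integrable (fun z =>
      1 - waveSign G r v z * waveSign G r (a v) z - waveSign G r v z * waveSign G r (b v) z) μ :=
    fun v => ((integrable_const _).sub (hint _ _)).sub (hint _ _)
  have hℓ3 : ∀ v, Integrable (fun z =>
      1 - waveSign G r v z * waveSign G r (a v) z) μ :=
    fun v => (integrable_const _).sub (hint _ _)
  have hℓ4 : ∀ v, Integrable (fun z =>
      (1 - waveSign G r v z * waveSign G r (a v) z - waveSign G r v z * waveSign G r (b v) z +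
        waveSign G r (a v) z * waveSign G r (b v) z) / 32) μ :=
    fun v => ((hℓ2 v).add (hint _ _)).div_const 32
  have hℓint : ∀ v, Integrable (ℓ v) μ := fun v =>
    (hℓ1 v).sub (hℓ4 v)
  set κ := 3 * neighborAngle r / (2 * π) -
        (2 * neighborAngle r - siblingAngle r) / (16 * π) with hκ
  have hℓval : ∀ v ∈ T, ∫ z, ℓ v z ∂μ = κ := by
    intro v hv
    have e1 : ∫ z, ∑ y ∈ G.neighborFinset v, waveSign G r v z * waveSign G r y z ∂μ =
        3 * (1 - 2 * neighborAngle r / π) := by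
      rw [integral_finsetSum _ fun y _ => hint v y, Finset.sum_congr rfl fun y hy =>
        hcorr v hv y ((G.mem_neighborFinset v y).mp hy), Finset.sum_const,
        SimpleGraph.card_neighborFinset_eq_degree, hdeg v hv]
      simp
    rw [hℓ]
    simp only
    rw [integral_sub (hℓ1 v) (hℓ4 v),
      integral_sub (integrable_const _) ((integrable_finsetSum _ fun y _ => hint v y).div_const 4),
      integral_div, integral_div, integral_div, e1, integral_add (hℓ2 v) (hint _ _),
      integral_sub (hℓ3 v) (hint _ _), integral_sub (integrable_const _) (hint _ _),
      hcorr v hv _ (hva v hv), hcorr v hv _ (hvb v hv), hcorr' v hv]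
    simp only [integral_const, probReal_univ, smul_eq_mul, one_mul, hκ]
    field_simp
    ring
  have hX := integral_sum_sq_le hμ hT (m := r + 1) (by omega)
    fun v _ => isOddLocal_waveSign_self (G := G) r v
  have hY := integral_sum_sq_le hμ hT (m := r + 1) (by omega)
    fun v hv => (isOddLocal_waveSign_self (G := G) r v).mul_disagree
      (isOddLocal_waveSign_adj r (hva v hv)) (isOddLocal_waveSign_adj r (hvb v hv))
  set X : EuclideanSpace ℝ W → ℝ := fun z => ∑ v ∈ T, waveSign G r v z with hXdef
  set Y : EuclideanSpace ℝ W → ℝ := fun z => ∑ v ∈ T, waveSign G r v z *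
    ((1 - waveSign G r v z * waveSign G r (a v) z) *
      (1 - waveSign G r v z * waveSign G r (b v) z) / 4) with hYdef
  set q := √(Fintype.card W : ℝ) with hq
  have hcard : (0 : ℝ) < Fintype.card W := by exact_mod_cast Fintype.card_pos
  have hq0 : 0 < q := Real.sqrt_pos.mpr hcard
  have hqq : (T.card : ℝ) / q ≤ q := by
    rw [div_le_iff₀ hq0, hq, Real.mul_self_sqrt hcard.le]
    exact_mod_cast T.card_le_univ
  have hL : Integrable (fun z => ∑ v ∈ T, ℓ v z) μ := integrable_finsetSum _ fun v _ => hℓint v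
  have hX1 : Integrable (fun z => 3 / 4 * (X z ^ 2 / q + q)) μ :=
    ((hX.1.div_const q).add (integrable_const q)).const_mul _
  have hY1 : Integrable (fun z => (Y z ^ 2 / q + q) / 16) μ :=
    ((hY.1.div_const q).add (integrable_const q)).div_const _
  have hQ : Integrable (fun z => 3 / 4 * (X z ^ 2 / q + q) + (Y z ^ 2 / q + q) / 16) μ :=
    hX1.add hY1
  have hQval : ∫ z, (3 / 4 * (X z ^ 2 / q + q) + (Y z ^ 2 / q + q) / 16) ∂μ ≤
      (4 ^ (2 * m + 6) + 1) * q := by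
    rw [integral_add hX1 hY1, integral_const_mul,
      integral_div, integral_add (hX.1.div_const q) (integrable_const q),
      integral_add (hY.1.div_const q) (integrable_const q), integral_div, integral_div]
    simp only [integral_const, probReal_univ, smul_eq_mul, one_mul]
    have hexp : 2 * (r + 1) = 2 * m + 6 := by omega
    rw [hexp] at hX hY
    have hbound : ∀ x : ℝ, x ≤ T.card * 4 ^ (2 * m + 6) → x / q ≤ 4 ^ (2 * m + 6) * q := by
      intro x hx
      calc x / q ≤ T.card * 4 ^ (2 * m + 6) / q := by gcongr
        _ = 4 ^ (2 * m + 6) * (T.card / q) := by ring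
        _ ≤ _ := by gcongr
    have hp : 0 ≤ (4 : ℝ) ^ (2 * m + 6) * q := by positivity
    linarith [hbound _ hX.2, hbound _ hY.2]
  obtain ⟨z, hz, hle⟩ := exists_notMem_null_le_integral (hL.add hQ)
    (N := {z | ∃ v, inner ℝ (waveVector G r v) z = 0}) (by
      have h1 : ∀ᵐ z ∂μ, ∀ v, inner ℝ (waveVector G r v) z ≠ 0 :=
        ae_all_iff.mpr fun v => hμ.ae_inner_ne_zero _ (waveVector_ne_zero r v)
      rw [ae_iff] at h1
      simpa using h1)
  rw [integral_add' hL hQ, integral_finsetSum _ fun v _ => hℓint v, Finset.sum_congr rfl hℓval,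
    Finset.sum_const, nsmul_eq_mul] at hle
  have hs : ∀ v, waveSign G r v z = 1 ∨ waveSign G r v z = -1 := fun v =>
    (Real.sign_apply_eq_of_ne_zero _ fun h => hz ⟨v, h⟩).symm
  obtain ⟨S, hS, hSle⟩ := exists_bisection_le hTc hdeg hs
    (c := fun v => (1 - waveSign G r v z * waveSign G r (a v) z) *
      (1 - waveSign G r v z * waveSign G r (b v) z) / 4) (by
    intro v hv
    by_cases h : waveSign G r (a v) z = -waveSign G r v z ∧ waveSign G r (b v) z = -waveSign G r v z
    · refine Or.inr ⟨?_, a v, b v, hab v hv, hva v hv, hvb v hv, h.1, h.2⟩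
      rw [h.1, h.2]
      rcases hs v with h' | h' <;> rw [h'] <;> norm_num
    · left
      rcases hs v with h1 | h1 <;> rcases hs (a v) with h2 | h2 <;>
        rcases hs (b v) with h3 | h3 <;> rw [h1, h2, h3] at h ⊢ <;>
        first | (norm_num; done) | (norm_num at h))
  refine ⟨S, hS, ?_⟩
  have hcut := cutValue_le (G := G) hs hdeg
  have hXle := abs_le_sq_div_add (x := X z) hq0
  have hYle := abs_le_sq_div_add (x := Y z) hq0
  have hsum : ∑ v ∈ T, ℓ v z = ∑ v ∈ T, (3 / 4 - (∑ y ∈ G.neighborFinset v,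
      waveSign G r v z * waveSign G r y z) / 4) - (∑ v ∈ T,
      (1 - waveSign G r v z * waveSign G r (a v) z) *
      (1 - waveSign G r v z * waveSign G r (b v) z) / 4) / 8 := by
    rw [Finset.sum_div, ← Finset.sum_sub_distrib]
    refine Finset.sum_congr rfl fun v _ => ?_
    have h1 : waveSign G r v z * waveSign G r v z = 1 := by
      rcases hs v with h | h <;> rw [h] <;> norm_num
    rw [hℓ]
    linear_combination (waveSign G r (a v) z * waveSign G r (b v) z / 32) * h1
  simp only [Pi.add_apply] at hle
  linarith

end FiniteBound

section Asymptotics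

lemma tendsto_mul_div_one_add_mul (a b c : ℝ) (hc : c ≠ 0) :
    Tendsto (fun m : ℕ => (a * ((m + 2 : ℕ) : ℝ) + b) / (1 + c * ((m + 2 : ℕ) : ℝ))) atTop
      (nhds (a / c)) := by
  have h1 : Tendsto (fun m : ℕ => ((m + 2 : ℕ) : ℝ)⁻¹) atTop (nhds 0) :=
    (tendsto_inv_atTop_nhds_zero_nat (𝕜 := ℝ)).comp (tendsto_add_atTop_nat 2)
  have h2 := ((h1.const_mul b).const_add a).div (h1.add_const c) (by simpa using hc)
  rw [mul_zero, add_zero, zero_add] at h2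
  refine h2.congr fun m => ?_
  have hm : ((m + 2 : ℕ) : ℝ) ≠ 0 := by positivity
  simp only [Pi.div_apply]
  generalize ((m + 2 : ℕ) : ℝ) = x at hm ⊢
  rw [← mul_div_mul_right _ _ hm]
  congr 1 <;> field_simp

lemma arccos_five_sixths_lt : Real.arccos (5 / 6) < 2 * Real.arccos (2 * √2 / 3) := by
  have h2 : (√2 : ℝ) ^ 2 = 2 := Real.sq_sqrt (by norm_num)
  have h0 := Real.sqrt_nonneg 2
  have hpos : (0 : ℝ) ≤ 2 * √2 / 3 := by positivity
  have hle : 2 * √2 / 3 ≤ 1 := by nlinarith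
  have hcos : Real.cos (2 * Real.arccos (2 * √2 / 3)) = 7 / 9 := by
    rw [Real.cos_two_mul, Real.cos_arccos (by linarith) hle]
    linear_combination (8 / 9) * h2
  have hpi : 2 * Real.arccos (2 * √2 / 3) ≤ π := by
    have := Real.arccos_le_pi_div_two.mpr hpos
    linarith
  rw [← Real.arccos_cos (by linarith [Real.arccos_nonneg (2 * √2 / 3)]) hpi, hcos]
  exact Real.arccos_lt_arccos (by norm_num) (by norm_num) (by norm_num)

lemma exists_rate_lt : ∃ m : ℕ, 3 * neighborAngle (m + 2) / (2 * π) -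
    (2 * neighborAngle (m + 2) - siblingAngle (m + 2)) / (16 * π) <
      (3 / (2 * π)) * Real.arccos (2 * Real.sqrt 2 / 3) := by
  have h1 : Tendsto (fun m : ℕ => neighborAngle (m + 2)) atTop
      (nhds (Real.arccos (2 * √2 / 3))) := by
    have := tendsto_mul_div_one_add_mul (√2) 0 (3 / 2) (by norm_num)
    rw [show √2 / (3 / 2) = 2 * √2 / 3 by ring] at this
    simp only [add_zero] at this
    exact (Real.continuous_arccos.tendsto _).comp this
  have h2 : Tendsto (fun m : ℕ => siblingAngle (m + 2)) atTop (nhds (Real.arccos (5 / 6))) := by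
    have := tendsto_mul_div_one_add_mul (5 / 4) (-3 / 4) (3 / 2) (by norm_num)
    rw [show (5 / 4 : ℝ) / (3 / 2) = 5 / 6 by norm_num] at this
    refine ((Real.continuous_arccos.tendsto _).comp this).congr fun m => ?_
    rw [siblingAngle, Function.comp]
    congr 2
    ring
  have h3 := ((h1.const_mul 3).div_const (2 * π)).sub
    (((h1.const_mul 2).sub h2).div_const (16 * π))
  refine (h3.eventually_lt_const ?_).exists
  have h4 : 0 < (2 * Real.arccos (2 * √2 / 3) - Real.arccos (5 / 6)) / (16 * π) :=
    div_pos (sub_pos.mpr arccos_five_sixths_lt) (by positivity)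
  have h5 : 3 / (2 * π) * Real.arccos (2 * √2 / 3) = 3 * Real.arccos (2 * √2 / 3) / (2 * π) := by
    ring
  linarith

lemma IsLocalTree.mono {W : Type*} {G : SimpleGraph W} {R R' : ℕ} {v : W}
    (h : IsLocalTree G R v) (hR : R' ≤ R) : IsLocalTree G R' v :=
  ⟨fun u h1 h2 => h.1 u h1 (h2.trans_le hR), fun u y h1 h2 => h.2 u y h1 (h2.trans_le hR),
    fun u y y' h1 h2 => h.3 u y y' h1 (h2.trans_le hR)⟩

lemma TreeLikeVtx.lt_card {W : Type*} [Fintype W] {G : SimpleGraph W} {M : ℕ} {v : W}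
    (h : TreeLikeVtx G 3 (M + 2) v) : M < Fintype.card W := by
  classical
  have hv := h.isLocalTree
  have hd : G.degree v = 3 :=
    hv.degree_eq (SimpleGraph.Reachable.refl _) (by simp)
  obtain ⟨w, hw⟩ := (G.degree_pos_iff_exists_adj v).mp (by omega)
  have hw' := (TreeLikeVtx.of_adj h hw).isLocalTree
  have h1 := card_branch (hv.mono (Nat.le_succ _)) hw' hw (j := M) (by omega)
  calc M < 2 ^ M := Nat.lt_two_pow_self
    _ = _ := h1.symm
    _ ≤ _ := Finset.card_le_univ _

lemma tendsto_card {V : ℕ → Type} [∀ k, Fintype (V k)] {G : ∀ k, SimpleGraph (V k)}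
    (htree : ∀ r : ℕ, Tendsto
      (fun k => ({x : V k | TreeLikeVtx (G k) 3 r x}.ncard : ℝ) / (Fintype.card (V k)))
      atTop (nhds 1)) : Tendsto (fun k => (Fintype.card (V k) : ℝ)) atTop atTop := by
  rw [tendsto_natCast_atTop_iff, tendsto_atTop]
  intro M
  filter_upwards [(htree (M + 2)).eventually_const_lt zero_lt_one] with k hk
  obtain ⟨v, hv⟩ : {x : V k | TreeLikeVtx (G k) 3 (M + 2) x}.Nonempty := by
    rw [Set.nonempty_iff_ne_empty]
    intro h
    simp [h] at hk
  exact (TreeLikeVtx.lt_card hv).le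

end Asymptotics

/-- If the random weak limit of finite graphs `G k` is the 3-regular tree and the average
degree tends to 3, then the asymptotic minimum bisection is strictly less than
`(3/(2π)) arccos(2√2/3)`. -/
theorem minBisection_lt_of_cubic_treelike (V : ℕ → Type) [∀ k, Fintype (V k)]
    (G : ∀ k, SimpleGraph (V k))
    (htree : ∀ r : ℕ, Tendsto
      (fun k => ({x : V k | TreeLikeVtx (G k) 3 r x}.ncard : ℝ) / (Fintype.card (V k)))
      atTop (nhds 1))
    (hdeg : Tendsto
      (fun k => 2 * (((G k).edgeSet.ncard : ℝ)) / (Fintype.card (V k)))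
      atTop (nhds 3)) :
    limsup (fun k => sInf {q : ℝ | ∃ S : Set (V k), IsBisection S ∧
        q = (bisectionSize (G k) S : ℝ) / (Fintype.card (V k))}) atTop
      < (3 / (2 * π)) * Real.arccos (2 * Real.sqrt 2 / 3) := by
  obtain ⟨m, hm⟩ := exists_rate_lt
  set κ := 3 * neighborAngle (m + 2) / (2 * π) -
    (2 * neighborAngle (m + 2) - siblingAngle (m + 2)) / (16 * π)
  obtain ⟨c, hκc, hc⟩ := exists_between hm
  refine lt_of_le_of_lt ?_ hc
  have hn := tendsto_card htree
  set R := 2 * m + 6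
  have hlim := ((((htree (R + 1)).mul_const κ).add
    ((hdeg.sub ((htree (R + 1)).const_mul 3)).div_const 2)).add
    (((htree (R + 1)).const_sub 1).const_mul (3 / 2))).add
    ((hn.inv_tendsto_atTop.const_mul 2).add
    ((tendsto_sqrt_atTop.comp hn).inv_tendsto_atTop.const_mul ((4 : ℝ) ^ (2 * m + 6) + 1)))
  have hlt := hlim.eventually_lt_const (u := c) (by linarith)
  have hcob : IsCoboundedUnder (· ≤ ·) atTop fun k => sInf {q : ℝ | ∃ S : Set (V k),
      IsBisection S ∧ q = (bisectionSize (G k) S : ℝ) / (Fintype.card (V k))} := by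
    refine isCoboundedUnder_le_of_le atTop (x := 0) fun k => Real.sInf_nonneg ?_
    rintro q ⟨S, -, rfl⟩
    positivity
  refine limsup_le_of_le hcob ?_
  filter_upwards [hlt, hn.eventually_gt_atTop 0,
    (htree (R + 1)).eventually_const_lt (by norm_num : (1 / 2 : ℝ) < 1)] with k hk hpos hhalf
  classical
  have : Nonempty (V k) := Fintype.card_pos_iff.mp (by exact_mod_cast hpos)
  set T : Finset (V k) := Finset.univ.filter fun x => TreeLikeVtx (G k) 3 (R + 1) x with hT
  have hTmem : ∀ x ∈ T, TreeLikeVtx (G k) 3 (R + 1) x := fun x hx => (Finset.mem_filter.mp hx).2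
  have hTcard : {x : V k | TreeLikeVtx (G k) 3 (R + 1) x}.ncard = T.card := by
    rw [← Set.ncard_coe_finset, hT]
    simp
  rw [hTcard] at hk hhalf
  have hcompl : (T.card : ℝ) + Tᶜ.card = Fintype.card (V k) := by
    exact_mod_cast T.card_add_card_compl
  have hTc : 2 * Tᶜ.card ≤ Fintype.card (V k) := by
    rw [lt_div_iff₀ hpos] at hhalf
    have : 2 * (Tᶜ.card : ℝ) ≤ Fintype.card (V k) := by linarith
    exact_mod_cast this
  obtain ⟨S, hS, hSle⟩ := exists_small_bisection (G := G k) (m := m) (R := R) le_rfl hTc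
    (fun v hv => (hTmem v hv).isLocalTree.mono (Nat.le_succ R))
    (fun v hv w hw => (TreeLikeVtx.of_adj (hTmem v hv) hw).isLocalTree)
  have hbdd : BddBelow {q : ℝ | ∃ S : Set (V k), IsBisection S ∧
      q = (bisectionSize (G k) S : ℝ) / (Fintype.card (V k))} := by
    refine ⟨0, ?_⟩
    rintro q ⟨S, -, rfl⟩
    positivity
  refine (csInf_le hbdd ⟨S, hS, rfl⟩).trans (le_trans ?_ hk.le)
  rw [div_le_iff₀ hpos]
  refine hSle.trans (le_of_eq ?_)
  have hsq : √(Fintype.card (V k) : ℝ) * √(Fintype.card (V k) : ℝ) = Fintype.card (V k) :=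
    Real.mul_self_sqrt hpos.le
  have hsq0 : 0 < √(Fintype.card (V k) : ℝ) := Real.sqrt_pos.mpr hpos
  have hinv : (√(Fintype.card (V k) : ℝ))⁻¹ * Fintype.card (V k) = √(Fintype.card (V k) : ℝ) := by
    rw [inv_mul_eq_div, div_eq_iff hsq0.ne', hsq]
  have hdiv : ∀ x : ℝ, x / (Fintype.card (V k) : ℝ) * Fintype.card (V k) = x :=
    fun x => div_mul_cancel₀ x hpos.ne'
  have hone : (Fintype.card (V k) : ℝ)⁻¹ * Fintype.card (V k) = 1 := inv_mul_cancel₀ hpos.ne'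
  simp only [Pi.inv_apply, Function.comp_apply]
  linear_combination (-(κ - 3 / 2 - 3 / 2)) * hdiv (T.card : ℝ) -
    1 / 2 * hdiv (2 * ((G k).edgeSet.ncard : ℝ)) - 2 * hone -
    ((4 : ℝ) ^ (2 * m + 6) + 1) * hinv + 3 / 2 * hcompl
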